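/- Let I_1 = B(x_{a_1}x_{b_1}, x_{c_1}x_{d_1}) and I_2 = B(x_{a_2}x_{b_2}, x_{c_2}x_{d_2}) be strongly stable ideals in S = K[x_1, …, x_n], where c_i < a_i ≤ b_i < d_i for i = 1, 2 and d_1 ≤ d_2. Then the collection G = G₁ ∪ G₂ ∪ G₃, where G₁ = { T_u T_v − T_{u'} T_{v'} : u·v = u'·v' and u, v ≻_rlex v' } marked at T_u T_v, G₂ = { Z_u Z_v − Z_{u'} Z_{v'} : u·v = u'·v' and u, v ≻_mrlex v' } marked at Z_u Z_v, and G₃ = { T_u Z_v − T_{u'} Z_{v'} : u·v = u'·v' and v ≻_mrlex v' } marked at T_u Z_v, is a Gröbner basis of the toric ideal T(I_1 ⊕ I_2) with respect to the head and tail order ≻_ht on K[T_u, Z_v], with the marked terms as initial terms. -/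

import Mathlib

/-- A marked binomial: the difference of two monomials (given by exponent vectors),
with `head` chosen as the marked term. -/
structure MarkedBinomial (V : Type*) where
  head : V →₀ ℕ
  tail : V →₀ ℕ

/-- The polynomial associated to a marked binomial. -/
noncomputable def MarkedBinomial.toPoly {V : Type*} (K : Type*) [Field K]
    (g : MarkedBinomial V) : MvPolynomial V K :=
  MvPolynomial.monomial g.head 1 - MvPolynomial.monomial g.tail 1

/-- Transport a marked binomial along a map of variables. -/
noncomputable def MarkedBinomial.map {V W : Type*} (f : V → W) (g : MarkedBinomial V) :
    MarkedBinomial W :=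
  ⟨Finsupp.mapDomain f g.head, Finsupp.mapDomain f g.tail⟩

/-- A monomial order on the exponent vectors `V →₀ ℕ`: a strict total order, compatible
with addition, for which `1` (the zero exponent vector) is the smallest monomial. -/
structure MonomialOrd (V : Type*) where
  gt : (V →₀ ℕ) → (V →₀ ℕ) → Prop
  irrefl : ∀ m, ¬ gt m m
  trans : ∀ {m₁ m₂ m₃}, gt m₁ m₂ → gt m₂ m₃ → gt m₁ m₃
  total : ∀ m₁ m₂, m₁ ≠ m₂ → gt m₁ m₂ ∨ gt m₂ m₁
  add_right : ∀ {m₁ m₂} (m₃), gt m₁ m₂ → gt (m₁ + m₃) (m₂ + m₃)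
  gt_zero : ∀ m, m ≠ 0 → gt m 0

/-- `m` is the initial (leading) exponent of `f` with respect to the strict order `gt`. -/
def IsInitialTerm {V K : Type*} [Field K] (gt : (V →₀ ℕ) → (V →₀ ℕ) → Prop)
    (f : MvPolynomial V K) (m : V →₀ ℕ) : Prop :=
  m ∈ f.support ∧ ∀ m' ∈ f.support, m' ≠ m → gt m m'

/-- A set `G` of marked binomials is a Gröbner basis of the ideal `J` with respect to the
order `gt`, with the marked terms as initial terms: `G ⊆ J`, each marked term is the
initial term of its binomial, and the marked terms generate the initial ideal of `J`. -/
def IsMarkedGB {V K : Type*} [Field K] (gt : (V →₀ ℕ) → (V →₀ ℕ) → Prop)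
    (G : Set (MarkedBinomial V)) (J : Ideal (MvPolynomial V K)) : Prop :=
  (∀ g ∈ G, g.toPoly K ∈ J) ∧ (∀ g ∈ G, gt g.head g.tail) ∧
    Ideal.span ((fun g => (MvPolynomial.monomial g.head (1 : K) : MvPolynomial V K)) '' G) =
      Ideal.span {p : MvPolynomial V K |
        ∃ f ∈ J, f ≠ 0 ∧ ∃ m, IsInitialTerm gt f m ∧ p = MvPolynomial.monomial m (1 : K)}

/-- One-step reduction of a monomial (exponent vector) with respect to a collection of
marked binomials: replace an occurrence of a marked term by the corresponding tail. -/
def Reduces {V : Type*} (G : Set (MarkedBinomial V)) (m m' : V →₀ ℕ) : Prop :=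
  ∃ g ∈ G, g.head ≤ m ∧ m' = m - g.head + g.tail

/-- One-step reduction of a polynomial with respect to a collection of marked binomials. -/
noncomputable def PolyReduces {V K : Type*} [Field K] (G : Set (MarkedBinomial V))
    (f f' : MvPolynomial V K) : Prop :=
  ∃ g ∈ G, ∃ m ∈ f.support, g.head ≤ m ∧
    f' = f - MvPolynomial.monomial (m - g.head) (MvPolynomial.coeff m f) * g.toPoly K

/-- The image monomial (in the `W`-variables) of a monomial `T` in the `V`-variables under
the monomial map sending the variable `v` to the monomial with exponent vector `u v`. -/
noncomputable def fiberMap {V W : Type*} (u : V → (W →₀ ℕ)) (T : V →₀ ℕ) : W →₀ ℕ :=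
  T.sum fun v e => e • u v

/-- `T` is a sink of the fiber graph over the multidegree `μ` (with respect to the
marked binomials `G` and the monomial map determined by `u`): it lies in the fiber and
has no outgoing edge inside the fiber. -/
noncomputable def IsFiberSink {V W : Type*} (G : Set (MarkedBinomial V)) (u : V → (W →₀ ℕ))
    (μ : W →₀ ℕ) (T : V →₀ ℕ) : Prop :=
  fiberMap u T = μ ∧ ∀ T', Reduces G T T' → fiberMap u T' ≠ μ

/-- `I` is a monomial ideal. -/
def IsMonomialIdeal {n : ℕ} {K : Type*} [Field K] (I : Ideal (MvPolynomial (Fin n) K)) : Prop :=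
  ∃ M : Set (Fin n →₀ ℕ), I = Ideal.span ((fun m => (MvPolynomial.monomial m (1 : K))) '' M)

/-- `I` is a strongly stable (Borel) ideal: a monomial ideal such that whenever `x_i`
divides a monomial `m ∈ I` and `j < i`, also `x_j · m / x_i ∈ I`. -/
def StronglyStable {n : ℕ} {K : Type*} [Field K] (I : Ideal (MvPolynomial (Fin n) K)) : Prop :=
  IsMonomialIdeal I ∧ ∀ m : Fin n →₀ ℕ, MvPolynomial.monomial m (1 : K) ∈ I →
    ∀ i j : Fin n, j < i → m i ≠ 0 →
      MvPolynomial.monomial (m - Finsupp.single i 1 + Finsupp.single j 1) (1 : K) ∈ I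

/-- The smallest strongly stable ideal containing the given monomials. -/
noncomputable def smallestStronglyStable {n : ℕ} (K : Type*) [Field K]
    (Ms : Set (Fin n →₀ ℕ)) : Ideal (MvPolynomial (Fin n) K) :=
  sInf {I | StronglyStable I ∧ ∀ m ∈ Ms, MvPolynomial.monomial m (1 : K) ∈ I}

/-- The minimal monomial generators of an ideal generated in the single degree `d`:
the degree-`d` monomials lying in `I`. -/
def MinGens {n : ℕ} {K : Type*} [Field K] (I : Ideal (MvPolynomial (Fin n) K)) (d : ℕ) :
    Set (Fin n →₀ ℕ) :=
  {m | (m.sum fun _ e => e) = d ∧ MvPolynomial.monomial m (1 : K) ∈ I}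

/-- `u ≻_rlex v` (reverse lexicographic, `x_1 > … > x_n`, for exponent vectors of equal
total degree): at the largest index where they differ, `u` has the smaller exponent. -/
def RlexGt {n : ℕ} (u v : Fin n →₀ ℕ) : Prop :=
  ∃ k : Fin n, u k < v k ∧ ∀ l : Fin n, k < l → u l = v l

/-- The (degree-)reverse lexicographic order on monomials of `K[V]` induced by the strict
variable order `vgt` (where `vgt k l` means the variable `k` is greater than `l`). -/
def VarRevlexGt {V : Type*} (vgt : V → V → Prop) (m m' : V →₀ ℕ) : Prop :=
  (m.sum fun _ e => e) > (m'.sum fun _ e => e) ∨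
    ((m.sum fun _ e => e) = (m'.sum fun _ e => e) ∧
      ∃ k, m k < m' k ∧ ∀ l, vgt k l → m l = m' l)

/-- The minimal monomial generators of the strongly stable ideal `B(x_a x_b)` (`a ≤ b`):
the monomials `x_i x_j` with `i ≤ j`, `i ≤ a`, `j ≤ b`. -/
def BM {n : ℕ} (a b : Fin n) : Set (Fin n →₀ ℕ) :=
  {m | ∃ i j : Fin n, i ≤ j ∧ i ≤ a ∧ j ≤ b ∧ m = Finsupp.single i 1 + Finsupp.single j 1}

/-- The minimal monomial generators of `B(x_c x_d)` not in `B(x_a x_b)` (for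
`c < a ≤ b < d`): the monomials `x_i x_j` with `i ≤ c` and `b < j ≤ d`. -/
def BN {n : ℕ} (b c d : Fin n) : Set (Fin n →₀ ℕ) :=
  {m | ∃ i j : Fin n, i ≤ c ∧ b < j ∧ j ≤ d ∧ m = Finsupp.single i 1 + Finsupp.single j 1}

/-- `u ≻_mrlex v`: every element of `B_N` is greater than every element of `B_M`, and
within `B_M` (resp. `B_N`) the order agrees with `≻_rlex`. -/
def MrlexGt {n : ℕ} (a b c d : Fin n) (u v : Fin n →₀ ℕ) : Prop :=
  (u ∈ BN b c d ∧ v ∈ BM a b) ∨ (u ∈ BM a b ∧ v ∈ BM a b ∧ RlexGt u v) ∨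
    (u ∈ BN b c d ∧ v ∈ BN b c d ∧ RlexGt u v)

/-- The collection `G₁` of marked binomials `T_u T_v − T_{u'} T_{v'}` with `u v = u' v'`
and `u, v ≻_rlex v'`, marked at `T_u T_v`. -/
def G1 {n : ℕ} (a b c d : Fin n) : Set (MarkedBinomial ↥(BM a b ∪ BN b c d)) :=
  {g | ∃ u v u' v' : ↥(BM a b ∪ BN b c d),
    (u : Fin n →₀ ℕ) + (v : Fin n →₀ ℕ) = (u' : Fin n →₀ ℕ) + (v' : Fin n →₀ ℕ) ∧
    RlexGt (u : Fin n →₀ ℕ) (v' : Fin n →₀ ℕ) ∧ RlexGt (v : Fin n →₀ ℕ) (v' : Fin n →₀ ℕ) ∧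
    g.head = Finsupp.single u 1 + Finsupp.single v 1 ∧
    g.tail = Finsupp.single u' 1 + Finsupp.single v' 1}

/-- The collection `G₂` of marked binomials `T_u T_v − T_{u'} T_{v'}` with `u v = u' v'`
and `u, v ≻_mrlex v'`, marked at `T_u T_v`. -/
def G2 {n : ℕ} (a b c d : Fin n) : Set (MarkedBinomial ↥(BM a b ∪ BN b c d)) :=
  {g | ∃ u v u' v' : ↥(BM a b ∪ BN b c d),
    (u : Fin n →₀ ℕ) + (v : Fin n →₀ ℕ) = (u' : Fin n →₀ ℕ) + (v' : Fin n →₀ ℕ) ∧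
    MrlexGt a b c d (u : Fin n →₀ ℕ) (v' : Fin n →₀ ℕ) ∧
    MrlexGt a b c d (v : Fin n →₀ ℕ) (v' : Fin n →₀ ℕ) ∧
    g.head = Finsupp.single u 1 + Finsupp.single v 1 ∧
    g.tail = Finsupp.single u' 1 + Finsupp.single v' 1}

/-- `w` is the smallest (with respect to the variable order induced by `≻_rlex`) variable
factor of the monomial `T` whose underlying monomial lies in `S`. -/
def IsLeastFactorIn {n : ℕ} {V : Set (Fin n →₀ ℕ)} (S : Set (Fin n →₀ ℕ))
    (T : ↥V →₀ ℕ) (w : ↥V) : Prop :=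
  w ∈ T.support ∧ (w : Fin n →₀ ℕ) ∈ S ∧
    ∀ v ∈ T.support, (v : Fin n →₀ ℕ) ∈ S →
      v = w ∨ RlexGt (v : Fin n →₀ ℕ) (w : Fin n →₀ ℕ)

/-- `m` is the `≻_rlex`-smallest element of `S` dividing `μ`. -/
def IsLeastDivisorIn {n : ℕ} (S : Set (Fin n →₀ ℕ)) (μ m : Fin n →₀ ℕ) : Prop :=
  m ∈ S ∧ m ≤ μ ∧ ∀ m' ∈ S, m' ≤ μ → m' = m ∨ RlexGt m' m

/-- The head and tail variable order on `T`-variables (indexed by `S₁`) and `Z`-variables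
(indexed by `B_{M₂} ∪ B_{N₂}`): `T_u > T_v ⟺ u ≻_rlex v`, every `T`-variable is greater
than every `Z`-variable, and `Z_u > Z_v ⟺ u ≻_mrlex v`. -/
def HTVarGt {n : ℕ} (a₂ b₂ c₂ d₂ : Fin n) (S₁ S₂ : Set (Fin n →₀ ℕ)) :
    (↥S₁ ⊕ ↥S₂) → (↥S₁ ⊕ ↥S₂) → Prop :=
  fun w w' =>
    match w, w' with
    | Sum.inl u, Sum.inl v => RlexGt (u : Fin n →₀ ℕ) (v : Fin n →₀ ℕ)
    | Sum.inl _, Sum.inr _ => True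
    | Sum.inr _, Sum.inl _ => False
    | Sum.inr u, Sum.inr v => MrlexGt a₂ b₂ c₂ d₂ (u : Fin n →₀ ℕ) (v : Fin n →₀ ℕ)

/-- The collection `G₃` of marked binomials `T_u Z_v − T_{u'} Z_{v'}` with
`u v = u' v'` and `v ≻_mrlex v'`, marked at `T_u Z_v`. -/
def G3TZ {n : ℕ} (a₁ b₁ c₁ d₁ a₂ b₂ c₂ d₂ : Fin n) :
    Set (MarkedBinomial (↥(BM a₁ b₁ ∪ BN b₁ c₁ d₁) ⊕ ↥(BM a₂ b₂ ∪ BN b₂ c₂ d₂))) :=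
  {g | ∃ (u u' : ↥(BM a₁ b₁ ∪ BN b₁ c₁ d₁)) (v v' : ↥(BM a₂ b₂ ∪ BN b₂ c₂ d₂)),
    (u : Fin n →₀ ℕ) + (v : Fin n →₀ ℕ) = (u' : Fin n →₀ ℕ) + (v' : Fin n →₀ ℕ) ∧
    MrlexGt a₂ b₂ c₂ d₂ (v : Fin n →₀ ℕ) (v' : Fin n →₀ ℕ) ∧
    g.head = Finsupp.single (Sum.inl u) 1 + Finsupp.single (Sum.inr v) 1 ∧
    g.tail = Finsupp.single (Sum.inl u') 1 + Finsupp.single (Sum.inr v') 1}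

/-- The full marked collection `G = G₁ ∪ G₂ ∪ G₃` for the pair of strongly stable ideals
`I₁ = B(x_{a₁}x_{b₁}, x_{c₁}x_{d₁})` and `I₂ = B(x_{a₂}x_{b₂}, x_{c₂}x_{d₂})`, with `G₁`
in the `T`-variables, `G₂` in the `Z`-variables, and `G₃` mixed. -/
noncomputable def GHT {n : ℕ} (a₁ b₁ c₁ d₁ a₂ b₂ c₂ d₂ : Fin n) :
    Set (MarkedBinomial (↥(BM a₁ b₁ ∪ BN b₁ c₁ d₁) ⊕ ↥(BM a₂ b₂ ∪ BN b₂ c₂ d₂))) :=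
  (MarkedBinomial.map Sum.inl '' G1 a₁ b₁ c₁ d₁) ∪
    (MarkedBinomial.map Sum.inr '' G2 a₂ b₂ c₂ d₂) ∪
    G3TZ a₁ b₁ c₁ d₁ a₂ b₂ c₂ d₂

/-- The monomial map sending `T_u ↦ u·t` and `Z_v ↦ v·z`, on the level of exponent
vectors, with `t, z` the two extra variables `Sum.inr 0`, `Sum.inr 1`. -/
noncomputable def TZexp {n : ℕ} (S₁ S₂ : Set (Fin n →₀ ℕ)) :
    (↥S₁ ⊕ ↥S₂) → ((Fin n ⊕ Fin 2) →₀ ℕ) :=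
  Sum.elim
    (fun u => Finsupp.mapDomain Sum.inl (u : Fin n →₀ ℕ) +
      Finsupp.single (Sum.inr 0) 1)
    (fun v => Finsupp.mapDomain Sum.inl (v : Fin n →₀ ℕ) +
      Finsupp.single (Sum.inr 1) 1)

/-- The pairs `{x, y}` with `x_x x_y` in `B(x_a x_b)`. -/
def PairBM (a b x y : ℕ) : Prop := (x ≤ a ∧ y ≤ b) ∨ (y ≤ a ∧ x ≤ b)

/-- The pairs `{x, y}` with `x_x x_y` in `B(x_c x_d)` but not in `B(x_a x_b)`. -/
def PairBN (b c d x y : ℕ) : Prop := (x ≤ c ∧ b < y ∧ y ≤ d) ∨ (y ≤ c ∧ b < x ∧ x ≤ d)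

/-- The pairs `{x, y}` with `x_x x_y` in `B(x_a x_b, x_c x_d)`. -/
def PairIn (a b c d x y : ℕ) : Prop := PairBM a b x y ∨ PairBN b c d x y

/-- The reverse lexicographic order on unordered pairs of indices. -/
def PairRlex (x y x' y' : ℕ) : Prop :=
  max x y < max x' y' ∨ (max x y = max x' y' ∧ min x y < min x' y')

/-- Combinatorial data extracted from a monomial none of whose quadratic factors is a marked
term and all of whose `Z`-factors come from `B_{N₂}`: `T x y` and `Z p q` record the variables
dividing the monomial, `D x y` records that `T_{x y}` divides it twice, and `w` is the pair of a
`Z`-variable of type `B_{M₂}` dividing another monomial in the same fiber. -/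
structure TailConfig (a₁ b₁ c₁ d₁ a₂ b₂ c₂ d₂ : ℕ) (T Z D : ℕ → ℕ → Prop) (i j : ℕ) : Prop where
  symm : ∀ {x y}, T x y → T y x
  mem : ∀ {x y}, T x y → PairIn a₁ b₁ c₁ d₁ x y
  bn : ∀ {p q}, Z p q → p ≤ c₂ ∧ b₂ < q ∧ q ≤ d₂
  bm : i ≤ a₂ ∧ j ≤ b₂
  swap_tail : ∀ {x y p q}, T x y → Z p q → PairIn a₁ b₁ c₁ d₁ x q → q < y → y ≤ d₂ → False
  drop_tail : ∀ {x y p q}, T x y → Z p q → PairIn a₁ b₁ c₁ d₁ x q → y ≤ b₂ → False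
  swap_both : ∀ {x y p q}, T x y → Z p q → PairIn a₁ b₁ c₁ d₁ p q → PairBM a₂ b₂ x y → False
  swap_T : ∀ {x y x' y'}, T x y → T x' y' → (x ≠ x' ∨ y ≠ y' ∨ D x y) →
    PairIn a₁ b₁ c₁ d₁ x x' → PairIn a₁ b₁ c₁ d₁ y y' → PairRlex x y x x' →
    PairRlex x' y' x x' → False
  weight : ∀ (f : ℕ → ℤ) (A B : ℤ), (∀ x y, PairIn a₁ b₁ c₁ d₁ x y → f x + f y ≤ A) →
    (∀ x y, PairIn a₂ b₂ c₂ d₂ x y → f x + f y ≤ B) → (∀ x y, T x y → f x + f y = A) →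
    (∀ p q, Z p q → f p + f q = B) → B ≤ f i + f j
  weight_defect : ∀ (f : ℕ → ℤ) (A B : ℤ) (x₀ y₀ : ℕ), ¬ D x₀ y₀ →
    (∀ x y, PairIn a₁ b₁ c₁ d₁ x y → f x + f y ≤ A) →
    (∀ x y, PairIn a₂ b₂ c₂ d₂ x y → f x + f y ≤ B) →
    (∀ x y, T x y → f x + f y = A ∨ (x = x₀ ∧ y = y₀) ∨ (x = y₀ ∧ y = x₀)) →
    A - 1 ≤ f x₀ + f y₀ → (∀ p q, Z p q → f p + f q = B) → B - 1 ≤ f i + f j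

namespace TailConfig

variable {a₁ b₁ c₁ d₁ a₂ b₂ c₂ d₂ : ℕ} {T Z D : ℕ → ℕ → Prop} {i j : ℕ}

/-- With `b₂` and `d₁` below every second index of a `Z`-factor, the number of indices above
`max b₂ d₁` is maximal on the `Z`-part. -/
theorem le_d (C : TailConfig a₁ b₁ c₁ d₁ a₂ b₂ c₂ d₂ T Z D i j)
    (h11 : c₁ < a₁) (h12 : a₁ ≤ b₁) (h13 : b₁ < d₁) (h21 : c₂ < a₂) (h22 : a₂ ≤ b₂) {q₀ : ℕ}
    (hq₀ : ∀ p q, Z p q → q₀ ≤ q) : q₀ ≤ d₁ := by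
  by_contra! hlt
  have := C.weight (fun x => if max b₂ d₁ < x then 1 else 0) 0 1
    (by intro x y h; simp only [PairIn, PairBM, PairBN] at h; grind)
    (by intro x y h; simp only [PairIn, PairBM, PairBN] at h; grind)
    (by intro x y h; have := C.mem h; simp only [PairIn, PairBM, PairBN] at this; grind)
    (by intro x y h; have := C.bn h; have := hq₀ _ _ h; grind)
  have := C.bm
  grind

/-- Some `T`-factor has an index at most `b₂`. -/
theorem exists_le_b (C : TailConfig a₁ b₁ c₁ d₁ a₂ b₂ c₂ d₂ T Z D i j)
    (h21 : c₂ < a₂) (h22 : a₂ ≤ b₂) :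
    ∃ x y, T x y ∧ x ≤ b₂ := by
  by_contra! hall
  have := C.weight (fun x => if b₂ < x then 1 else 0) 2 1
    (by intro x y h; grind)
    (by intro x y h; simp only [PairIn, PairBM, PairBN] at h; grind)
    (by intro x y h; have := hall _ _ h; have := hall _ _ (C.symm h); grind)
    (by intro x y h; have := C.bn h; grind)
  have := C.bm
  grind

/-- Some `T`-factor has no index above `max a₁ b₂`. -/
theorem exists_le_max (C : TailConfig a₁ b₁ c₁ d₁ a₂ b₂ c₂ d₂ T Z D i j)
    (h11 : c₁ < a₁)
    (h21 : c₂ < a₂) (h22 : a₂ ≤ b₂) {q₀ : ℕ}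
    (hq₀ : ∀ p q, Z p q → q₀ ≤ q) (hq : max a₁ b₂ < q₀) :
    ∃ x y, T x y ∧ x ≤ max a₁ b₂ ∧ y ≤ max a₁ b₂ := by
  by_contra! hall
  have := C.weight (fun x => if max a₁ b₂ < x then 1 else 0) 1 1
    (by intro x y h; simp only [PairIn, PairBM, PairBN] at h; grind)
    (by intro x y h; simp only [PairIn, PairBM, PairBN] at h; grind)
    (by intro x y h; have := hall _ _ h; have := C.mem h
        simp only [PairIn, PairBM, PairBN] at this; grind)
    (by intro x y h; have := C.bn h; have := hq₀ _ _ h; grind)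
  have := C.bm
  grind

/-- Some `T`-factor has both indices at most `max b₂ c₁`. -/
theorem exists_le_max_c (C : TailConfig a₁ b₁ c₁ d₁ a₂ b₂ c₂ d₂ T Z D i j)
    (h11 : c₁ < a₁) (h12 : a₁ ≤ b₁)
    (h21 : c₂ < a₂) (h22 : a₂ ≤ b₂) {q₀ x₁ y₁ : ℕ}
    (hq₀ : ∀ p q, Z p q → q₀ ≤ q) (hq : max b₁ b₂ < q₀)
    (h₁ : T x₁ y₁) (hx₁ : x₁ ≤ max a₁ b₂) (hy₁ : y₁ ≤ max a₁ b₂) :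
    ∃ x y, T x y ∧ x ≤ max b₂ c₁ ∧ y ≤ max b₂ c₁ := by
  by_contra! hall
  wlog hxy : x₁ ≤ y₁ generalizing x₁ y₁
  · exact this (C.symm h₁) hy₁ hx₁ (by omega)
  have hm₁ := C.mem h₁
  have hall₁ := hall _ _ h₁
  have hdef : ∀ x y, T x y → x ≤ max b₂ c₁ → y ≤ max b₁ b₂ →
      y ≤ a₁ ∧ max b₂ c₁ < y ∧ x ≤ a₁ := by
    intro x y h hx hy
    have hm := C.mem h
    have hall' := hall _ _ h hx
    refine ⟨?_, hall', ?_⟩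
    · by_contra! hya
      by_cases hx₁' : x₁ ≤ max b₂ c₁
      · refine C.swap_T (C.symm h) (C.symm h₁) ?_ ?_ ?_ ?_ ?_ <;>
          simp only [PairIn, PairBM, PairBN, PairRlex] at * <;> omega
      · refine C.swap_T h₁ (C.symm h) ?_ ?_ ?_ ?_ ?_ <;>
          simp only [PairIn, PairBM, PairBN, PairRlex] at * <;> omega
    · simp only [PairIn, PairBM, PairBN] at *; omega
  have hA : ∀ x y, PairIn a₁ b₁ c₁ d₁ x y →
      (if x ≤ max b₂ c₁ then (0 : ℤ) else if x ≤ max b₁ b₂ then 1 else 2) +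
      (if y ≤ max b₂ c₁ then 0 else if y ≤ max b₁ b₂ then 1 else 2) ≤ 2 := by
    intro x y h; simp only [PairIn, PairBM, PairBN] at h; split_ifs <;> omega
  have hB : ∀ x y, PairIn a₂ b₂ c₂ d₂ x y →
      (if x ≤ max b₂ c₁ then (0 : ℤ) else if x ≤ max b₁ b₂ then 1 else 2) +
      (if y ≤ max b₂ c₁ then 0 else if y ≤ max b₁ b₂ then 1 else 2) ≤ 2 := by
    intro x y h; simp only [PairIn, PairBM, PairBN] at h; split_ifs <;> omega
  have hZ : ∀ x y, Z x y →
      (if x ≤ max b₂ c₁ then (0 : ℤ) else if x ≤ max b₁ b₂ then 1 else 2) +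
      (if y ≤ max b₂ c₁ then 0 else if y ≤ max b₁ b₂ then 1 else 2) = 2 := by
    intro x y h; have := C.bn h; have := hq₀ _ _ h; split_ifs <;> omega
  have hw := C.bm
  by_cases hex : ∃ x y, T x y ∧ x ≤ max b₂ c₁ ∧ y ≤ max b₁ b₂
  · obtain ⟨x, y, h, hx, hy⟩ := hex
    have hd := hdef _ _ h hx hy
    have huniq : ∀ x' y', T x' y' → x' ≤ max b₂ c₁ → y' ≤ max b₁ b₂ →
        y ≠ y' ∨ x ≠ x' ∨ D y x → False := by
      intro x' y' h' hx' hy' hne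
      have hd' := hdef _ _ h' hx' hy'
      refine C.swap_T (C.symm h) (C.symm h') hne ?_ ?_ ?_ ?_ <;>
          simp only [PairIn, PairBM, PairBN, PairRlex] at * <;> omega
    have := C.weight_defect _ 2 2 y x (fun hD => huniq x y h hx hy (Or.inr (Or.inr hD))) hA hB
      (by
        intro x' y' h'
        have hm' := C.mem h'
        have h1 := hall _ _ h'
        have h2 := huniq _ _ h'
        have h3 := huniq _ _ (C.symm h')
        simp only [PairIn, PairBM, PairBN] at hm'
        by_cases e1 : x' = x ∧ y' = y
        · right; right; exact e1
        by_cases e2 : x' = y ∧ y' = x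
        · right; left; exact e2
        left
        have h2' : ¬ (x' ≤ max b₂ c₁ ∧ y' ≤ max b₁ b₂) := fun ⟨e, e'⟩ => h2 e e' (by omega)
        have h3' : ¬ (y' ≤ max b₂ c₁ ∧ x' ≤ max b₁ b₂) := fun ⟨e, e'⟩ => h3 e e' (by omega)
        clear h2 h3 huniq hA hB hZ hdef
        split_ifs <;> omega)
      (by split_ifs <;> omega) hZ
    split_ifs at this <;> omega
  · push Not at hex
    have := C.weight _ 2 2 hA hB
      (by
        intro x' y' h'
        have hm' := C.mem h'
        have h1 := hall _ _ h'
        have h2 := hex _ _ h'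
        have h3 := hex _ _ (C.symm h')
        simp only [PairIn, PairBM, PairBN] at hm'
        clear hA hB hZ hdef
        split_ifs <;> omega) hZ
    split_ifs at this <;> omega

/-- Some `T`-factor has an index at most `c₁` paired with an index at most `max b₁ b₂`, when the
first indices of the `Z`-factors exceed `c₁`. -/
theorem exists_le_c (C : TailConfig a₁ b₁ c₁ d₁ a₂ b₂ c₂ d₂ T Z D i j)
    (h11 : c₁ < a₁) (h12 : a₁ ≤ b₁) (h21 : c₂ < a₂) (h22 : a₂ ≤ b₂)
    (hmin : ∀ p q, Z p q → c₁ < p ∧ max b₁ b₂ < q) :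
    ∃ x y, T x y ∧ x ≤ c₁ ∧ y ≤ max b₁ b₂ := by
  by_contra! large
  have := C.weight (fun x => if x ≤ c₁ then -1 else if max b₁ b₂ < x then 1 else 0) 0 1
    (by intro x y h; simp only [PairIn, PairBM, PairBN] at h; split_ifs <;> omega)
    (by intro x y h; simp only [PairIn, PairBM, PairBN] at h; split_ifs <;> omega)
    (by
      intro x y h
      have hm := C.mem h
      have hl := large _ _ h
      have hl' := large _ _ (C.symm h)
      simp only [PairIn, PairBM, PairBN] at hm; split_ifs <;> omega)
    (by intro x y h; have := C.bn h; have := hmin _ _ h; split_ifs <;> omega)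
  have hw := C.bm
  split_ifs at this <;> omega

/-- Some `T`-factor has an index at most `c₁` paired with an index at most `max b₁ b₂`, when the
`T`-factors with both indices above `c₁` have them above `a₂` and `c₂` as well. -/
theorem exists_le_c_of_lt (C : TailConfig a₁ b₁ c₁ d₁ a₂ b₂ c₂ d₂ T Z D i j)
    (h11 : c₁ < a₁) (h12 : a₁ ≤ b₁) (h21 : c₂ < a₂) (h22 : a₂ ≤ b₂)
    (hmin : ∀ p q, Z p q → max b₁ b₂ < q)
    (hT : ∀ x y, T x y → c₁ < x → c₁ < y → a₂ < x) :
    ∃ x y, T x y ∧ x ≤ c₁ ∧ y ≤ max b₁ b₂ := by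
  by_contra! large
  have := C.weight
    (fun x => if x ≤ max c₁ c₂ then -1 else if x ≤ a₂ then 0 else
      if x ≤ max b₁ b₂ then 1 else 3) 2 2
    (by intro x y h; simp only [PairIn, PairBM, PairBN] at h; split_ifs <;> omega)
    (by intro x y h; simp only [PairIn, PairBM, PairBN] at h; split_ifs <;> omega)
    (by
      intro x y h
      have hm := C.mem h
      have hl := large _ _ h
      have hl' := large _ _ (C.symm h)
      have hm1 := hT _ _ h
      have hm2 := hT _ _ (C.symm h)
      simp only [PairIn, PairBM, PairBN] at hm; split_ifs <;> omega)
    (by intro x y h; have := C.bn h; have := hmin _ _ h; split_ifs <;> omega)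
  have hw := C.bm
  split_ifs at this <;> omega

set_option maxHeartbeats 2000000 in
/-- No such configuration exists. -/
theorem not_config (C : TailConfig a₁ b₁ c₁ d₁ a₂ b₂ c₂ d₂ T Z D i j)
    (h11 : c₁ < a₁) (h12 : a₁ ≤ b₁) (h13 : b₁ < d₁)
    (h21 : c₂ < a₂) (h22 : a₂ ≤ b₂) (hd : d₁ ≤ d₂) {p₀ q₀ : ℕ}
    (hz : Z p₀ q₀) (hmin : ∀ p q, Z p q → p₀ ≤ p ∧ q₀ ≤ q) : False := by
  have hz' := C.bn hz
  have hq₀ : ∀ p q, Z p q → q₀ ≤ q := fun p q h => (hmin p q h).2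
  have hqd := C.le_d h11 h12 h13 h21 h22 hq₀
  have le_q : ∀ {x y}, T x y → y ≤ q₀ := by
    intro x y h
    by_contra! hlt
    have hm := C.mem h
    refine C.swap_tail h hz ?_ hlt ?_ <;> simp only [PairIn, PairBM, PairBN] at * <;> omega
  have small : ∀ {x y}, T x y → y ≤ b₂ → ¬ PairIn a₁ b₁ c₁ d₁ x q₀ :=
    fun h hy hin => C.drop_tail h hz hin hy
  obtain ⟨x₀, y₀, h₀, hx₀⟩ := C.exists_le_b h21 h22
  have hm₀ := C.mem h₀
  have hs₀ := small (C.symm h₀) hx₀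
  have hs₀' := small h₀
  have hl₀ := le_q h₀
  have hqθ : max a₁ b₂ < q₀ := by
    simp only [PairIn, PairBM, PairBN] at *; omega
  obtain ⟨x₁, y₁, h₁, hx₁, hy₁⟩ := C.exists_le_max h11 h21 h22 hq₀ hqθ
  have hqb : b₁ < q₀ := by
    by_contra! hqb
    wlog hxy : x₁ ≤ y₁ generalizing x₁ y₁
    · exact this _ _ (C.symm h₁) hy₁ hx₁ (by omega)
    have hm₁ := C.mem h₁
    have hs₁ := small (C.symm h₁)
    have hs₁' := small h₁
    refine C.swap_T h₁ (C.symm h₀) ?_ ?_ ?_ ?_ ?_ <;>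
      simp only [PairIn, PairBM, PairBN, PairRlex] at * <;> omega
  obtain ⟨x₂, y₂, h₂, hx₂, hy₂⟩ :=
    C.exists_le_max_c h11 h12 h21 h22 hq₀ (by omega) h₁ hx₁ hy₁
  have small' : ∀ {x y}, T x y → x ≤ b₂ → c₁ < y := by
    intro x y h hx
    have := small (C.symm h) hx
    simp only [PairIn, PairBM, PairBN] at *; omega
  wlog hxy : x₂ ≤ y₂ generalizing x₂ y₂
  · exact this _ _ (C.symm h₂) hy₂ hx₂ (by omega)
  have hm₂ := C.mem h₂
  have hs₂ := small' h₂
  have hs₂' := small' (C.symm h₂)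
  have large : ∀ {x y}, T x y → x ≤ c₁ → max b₁ b₂ < y := by
    intro x y h hx
    by_contra! hy
    have hm := C.mem h
    have hs := small' h
    have hs' := small' (C.symm h)
    by_cases hy₂b : y₂ ≤ b₂
    · refine C.swap_T h₂ (C.symm h) ?_ ?_ ?_ ?_ ?_ <;>
        simp only [PairIn, PairBM, PairBN, PairRlex] at * <;> omega
    · have hs₀ := small' h₀ hx₀
      refine C.swap_T h₂ (C.symm h₀) ?_ ?_ ?_ ?_ ?_ <;>
        simp only [PairIn, PairBM, PairBN, PairRlex] at * <;> omega
  by_cases hp : c₁ < p₀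
  · obtain ⟨x, y, h, hx, hy⟩ := C.exists_le_c h11 h12 h21 h22
      (fun p q h => by have := hmin _ _ h; omega)
    exact absurd (large h hx) (by omega)
  have hin : PairIn a₁ b₁ c₁ d₁ p₀ q₀ := by
    simp only [PairIn, PairBM, PairBN]; omega
  have mid : ∀ {x y}, T x y → c₁ < x → c₁ < y → a₂ < x := by
    intro x y h hx hy
    by_contra! hxa
    have hm := C.mem h
    have hb : ¬ PairBM a₂ b₂ x y := fun hh => C.swap_both h hz hin hh
    have hb₂ : ¬ PairBM a₂ b₂ x₂ y₂ := fun hh => C.swap_both h₂ hz hin hh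
    clear hmin hq₀
    refine C.swap_T h₂ (C.symm h) ?_ ?_ ?_ ?_ ?_ <;>
        simp only [PairIn, PairBM, PairBN, PairRlex] at * <;> omega
  obtain ⟨x, y, h, hx, hy⟩ := C.exists_le_c_of_lt h11 h12 h21 h22
    (fun p q h => by have := hmin _ _ h; omega) (fun x y h => mid h)
  exact absurd (large h hx) (by omega)

end TailConfig

theorem fiberMap_add {V W : Type*} (u : V → (W →₀ ℕ)) (m m' : V →₀ ℕ) :
    fiberMap u (m + m') = fiberMap u m + fiberMap u m' :=
  Finsupp.sum_add_index' (fun _ => zero_smul ℕ _) (fun _ _ _ => add_smul _ _ _)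

theorem fiberMap_single {V W : Type*} (u : V → (W →₀ ℕ)) (v : V) :
    fiberMap u (Finsupp.single v 1) = u v := by
  simp [fiberMap]

/-- The monomial map sends monomials to monomials. -/
theorem aeval_monomial_one {V W K : Type*} [Field K] (u : V → (W →₀ ℕ)) (m : V →₀ ℕ) (c : K) :
    MvPolynomial.aeval (fun v => MvPolynomial.monomial (u v) (1 : K)) (MvPolynomial.monomial m c) =
      MvPolynomial.monomial (fiberMap u m) c := by
  rw [MvPolynomial.aeval_monomial, fiberMap, Finsupp.prod, Finsupp.sum,
    MvPolynomial.algebraMap_eq]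
  simp only [MvPolynomial.monomial_pow, one_pow]
  rw [← MvPolynomial.monomial_sum_one, MvPolynomial.C_mul_monomial, mul_one]

/-- A polynomial in a toric ideal whose support contains `m` also contains another monomial in
the fiber of `m`. -/
theorem exists_mem_support_of_mem_ker {V W K : Type*} [Field K] (u : V → (W →₀ ℕ))
    {f : MvPolynomial V K}
    (hf : MvPolynomial.aeval (fun v => MvPolynomial.monomial (u v) (1 : K)) f = 0)
    {m : V →₀ ℕ} (hm : m ∈ f.support) :
    ∃ m' ∈ f.support, m' ≠ m ∧ fiberMap u m' = fiberMap u m := by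
  classical
  by_contra! hall
  have hcoeff := congrArg (MvPolynomial.coeff (fiberMap u m)) hf
  rw [f.as_sum, map_sum, MvPolynomial.coeff_sum, Finset.sum_eq_single m] at hcoeff
  · rw [aeval_monomial_one, MvPolynomial.coeff_monomial, if_pos rfl, MvPolynomial.coeff_zero]
      at hcoeff
    exact MvPolynomial.mem_support_iff.mp hm hcoeff
  · intro m' hm' hne
    rw [aeval_monomial_one, MvPolynomial.coeff_monomial, if_neg (hall m' hm' hne)]
  · exact fun h => absurd hm h

/-- A criterion for a set of marked binomials to be a Gröbner basis of a toric ideal: every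
monomial which is greater than another monomial in its fiber is divisible by a marked term. -/
theorem isMarkedGB_of_fiberMap {V W K : Type*} [Field K] (u : V → (W →₀ ℕ))
    (gt : (V →₀ ℕ) → (V →₀ ℕ) → Prop) (G : Set (MarkedBinomial V))
    (irrefl : ∀ m, ¬ gt m m)
    (fiber_eq : ∀ g ∈ G, fiberMap u g.head = fiberMap u g.tail)
    (head_gt : ∀ g ∈ G, gt g.head g.tail)
    (exists_head_le : ∀ m m', fiberMap u m = fiberMap u m' → gt m m' → ∃ g ∈ G, g.head ≤ m) :
    IsMarkedGB gt G (RingHom.ker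
      (MvPolynomial.aeval (R := K) (fun v => MvPolynomial.monomial (u v) (1 : K))).toRingHom) := by
  classical
  classical
  have mem : ∀ g ∈ G, g.toPoly K ∈ RingHom.ker
      (MvPolynomial.aeval (R := K) (fun v => MvPolynomial.monomial (u v) (1 : K))).toRingHom := by
    intro g hg
    change MvPolynomial.aeval (R := K) _ (g.toPoly K) = 0
    rw [MarkedBinomial.toPoly, map_sub, aeval_monomial_one, aeval_monomial_one, fiber_eq g hg,
      sub_self]
  refine ⟨mem, head_gt, le_antisymm (Ideal.span_mono ?_) (Ideal.span_le.mpr ?_)⟩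
  · rintro _ ⟨g, hg, rfl⟩
    have hne : g.head ≠ g.tail := fun h => irrefl g.tail (by simpa [h] using head_gt g hg)
    have hcoeff : MvPolynomial.coeff g.head (g.toPoly K) = 1 := by
      simp [MarkedBinomial.toPoly, MvPolynomial.coeff_monomial, hne.symm]
    refine ⟨g.toPoly K, mem g hg, fun h => by simp [h] at hcoeff, g.head,
      ⟨by simp [MvPolynomial.mem_support_iff, hcoeff], ?_⟩, rfl⟩
    intro m' hm' hne'
    have : m' = g.tail := by
      by_contra hmt
      simp [MarkedBinomial.toPoly, MvPolynomial.coeff_monomial,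
        Ne.symm hne', Ne.symm hmt] at hm'
    exact this ▸ head_gt g hg
  · rintro _ ⟨f, hf, -, m, ⟨hm, hlead⟩, rfl⟩
    obtain ⟨m', hm', hne, hfib⟩ := exists_mem_support_of_mem_ker u hf hm
    obtain ⟨g, hg, hle⟩ := exists_head_le m m' hfib.symm (hlead m' hm' hne)
    have hmul : MvPolynomial.monomial m (1 : K) =
        MvPolynomial.monomial (m - g.head) 1 * MvPolynomial.monomial g.head 1 := by
      rw [MvPolynomial.monomial_mul, tsub_add_cancel_of_le hle, one_mul]
    rw [hmul]
    exact Ideal.mul_mem_left _ _ (Ideal.subset_span ⟨g, hg, rfl⟩)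

theorem RlexGt.irrefl {n : ℕ} (u : Fin n →₀ ℕ) : ¬ RlexGt u u :=
  fun ⟨_, h, _⟩ => lt_irrefl _ h

theorem RlexGt.trans {n : ℕ} {u v w : Fin n →₀ ℕ} (h : RlexGt u v) (h' : RlexGt v w) :
    RlexGt u w := by
  obtain ⟨k, hk, hk'⟩ := h
  obtain ⟨l, hl, hl'⟩ := h'
  rcases lt_trichotomy k l with hkl | rfl | hkl
  · exact ⟨l, hk' l hkl ▸ hl, fun i hi => (hk' i (hkl.trans hi)).trans (hl' i hi)⟩
  · exact ⟨k, hk.trans hl, fun i hi => (hk' i hi).trans (hl' i hi)⟩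
  · exact ⟨k, hl' k hkl ▸ hk, fun i hi => (hk' i hi).trans (hl' i (hkl.trans hi))⟩

/-- The quadratic monomial `x_i x_j`. -/
noncomputable def quad {n : ℕ} (i j : Fin n) : Fin n →₀ ℕ :=
  Finsupp.single i 1 + Finsupp.single j 1

theorem quad_comm {n : ℕ} (i j : Fin n) : quad i j = quad j i := add_comm _ _

theorem quad_eq_quad_iff {n : ℕ} {i j k l : Fin n} :
    quad i j = quad k l ↔ (i = k ∧ j = l) ∨ (i = l ∧ j = k) := by
  refine ⟨fun h => ?_, ?_⟩
  · have h1 := DFunLike.congr_fun h i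
    have h2 := DFunLike.congr_fun h j
    have h3 := DFunLike.congr_fun h k
    have h4 := DFunLike.congr_fun h l
    simp only [quad, Finsupp.add_apply, Finsupp.single_apply] at h1 h2 h3 h4
    grind
  · rintro (⟨rfl, rfl⟩ | ⟨rfl, rfl⟩)
    · rfl
    · exact quad_comm _ _

theorem rlexGt_quad_of_pairRlex {n : ℕ} {i j k l : Fin n} (h : PairRlex i j k l) :
    RlexGt (quad i j) (quad k l) := by
  wlog hij : i ≤ j generalizing i j
  · rw [quad_comm]
    exact this (by simpa only [PairRlex, max_comm, min_comm] using h) (le_of_not_ge hij)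
  wlog hkl : k ≤ l generalizing k l
  · rw [quad_comm k]
    exact this (by simpa only [PairRlex, max_comm, min_comm] using h) (le_of_not_ge hkl)
  have h' : j < l ∨ (j = l ∧ i < k) := by
    simp only [PairRlex] at h
    omega
  rcases h' with h' | ⟨rfl, h'⟩
  · refine ⟨l, ?_, fun x hx => ?_⟩
    · simp [quad, Finsupp.single_apply, h'.ne, (hij.trans_lt h').ne]
    · simp [quad, hx.ne, (hkl.trans_lt hx).ne, (h'.trans hx).ne,
        (hij.trans_lt (h'.trans hx)).ne]
  · refine ⟨k, ?_, fun x hx => ?_⟩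
    · simp [quad, Finsupp.single_apply, h'.ne]
    · simp [quad, Finsupp.single_apply, hx.ne, (h'.trans hx).ne]

theorem pairRlex_or_quad_eq {n : ℕ} (i j k l : Fin n) :
    PairRlex i j k l ∨ quad i j = quad k l ∨ PairRlex k l i j := by
  simp only [quad_eq_quad_iff, PairRlex, Fin.ext_iff]
  omega

theorem rlexGt_quad_iff {n : ℕ} {i j k l : Fin n} :
    RlexGt (quad i j) (quad k l) ↔ PairRlex i j k l := by
  refine ⟨fun h => ?_, rlexGt_quad_of_pairRlex⟩
  rcases pairRlex_or_quad_eq i j k l with h' | h' | h'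
  · exact h'
  · exact absurd (h' ▸ h) (RlexGt.irrefl _)
  · exact absurd (h.trans (rlexGt_quad_of_pairRlex h')) (RlexGt.irrefl _)

theorem quad_mem_BM_iff {n : ℕ} {a b : Fin n} (hab : a ≤ b) {i j : Fin n} :
    quad i j ∈ BM a b ↔ PairBM a b i j := by
  refine ⟨?_, fun h => ?_⟩
  · rintro ⟨k, l, hkl, hk, hl, h⟩
    change quad i j = quad k l at h
    simp only [quad_eq_quad_iff, PairBM, Fin.ext_iff] at *
    omega
  · rcases le_total i j with hij | hij
    · refine ⟨i, j, hij, ?_, ?_, rfl⟩ <;> simp only [PairBM] at h <;> omega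
    · refine ⟨j, i, hij, ?_, ?_, quad_comm i j⟩ <;> simp only [PairBM] at h <;> omega

theorem quad_mem_BN_iff {n : ℕ} {b c d : Fin n} {i j : Fin n} :
    quad i j ∈ BN b c d ↔ PairBN b c d i j := by
  refine ⟨?_, ?_⟩
  · rintro ⟨k, l, hk, hl, hl', h⟩
    change quad i j = quad k l at h
    simp only [quad_eq_quad_iff, PairBN, Fin.ext_iff] at *
    omega
  · rintro (⟨h1, h2, h3⟩ | ⟨h1, h2, h3⟩)
    · exact ⟨i, j, h1, h2, h3, rfl⟩
    · exact ⟨j, i, h1, h2, h3, quad_comm i j⟩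

theorem quad_mem_iff {n : ℕ} {a b c d : Fin n} (hab : a ≤ b) {i j : Fin n} :
    quad i j ∈ BM a b ∪ BN b c d ↔ PairIn a b c d i j := by
  rw [Set.mem_union, quad_mem_BM_iff hab, quad_mem_BN_iff, PairIn]

theorem exists_quad_of_mem {n : ℕ} {a b c d : Fin n} {v : Fin n →₀ ℕ}
    (h : v ∈ BM a b ∪ BN b c d) : ∃ i j : Fin n, i ≤ j ∧ v = quad i j := by
  rcases h with ⟨i, j, hij, -, -, rfl⟩ | ⟨i, j, -, -, -, rfl⟩
  · exact ⟨i, j, hij, rfl⟩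
  · rcases le_total i j with hij | hij
    · exact ⟨i, j, hij, rfl⟩
    · exact ⟨j, i, hij, quad_comm i j⟩

theorem not_mem_BN_of_mem_BM {n : ℕ} {a b c d : Fin n} (hab : a ≤ b)
    {v : Fin n →₀ ℕ} (h : v ∈ BM a b) : v ∉ BN b c d := by
  obtain ⟨i, j, -, rfl⟩ := exists_quad_of_mem (c := c) (d := d) (Or.inl h)
  rw [quad_mem_BM_iff hab] at h
  rw [quad_mem_BN_iff]
  simp only [PairBM, PairBN] at *
  omega

theorem mrlexGt_quad_iff {n : ℕ} {a b c d : Fin n} (hab : a ≤ b) {i j k l : Fin n} :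
    MrlexGt a b c d (quad i j) (quad k l) ↔
      (PairBN b c d i j ∧ PairBM a b k l) ∨
        (PairBM a b i j ∧ PairBM a b k l ∧ PairRlex i j k l) ∨
          (PairBN b c d i j ∧ PairBN b c d k l ∧ PairRlex i j k l) := by
  rw [MrlexGt, quad_mem_BM_iff hab, quad_mem_BM_iff hab, quad_mem_BN_iff, quad_mem_BN_iff,
    rlexGt_quad_iff]

theorem MrlexGt.irrefl {n : ℕ} {a b c d : Fin n} (hab : a ≤ b) (u : Fin n →₀ ℕ) :
    ¬ MrlexGt a b c d u u := by
  rintro (⟨h, h'⟩ | ⟨-, -, h⟩ | ⟨-, -, h⟩)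
  · exact not_mem_BN_of_mem_BM hab h' h
  · exact RlexGt.irrefl _ h
  · exact RlexGt.irrefl _ h

theorem MrlexGt.trans {n : ℕ} {a b c d : Fin n} (hab : a ≤ b)
    {u v w : Fin n →₀ ℕ} (h : MrlexGt a b c d u v) (h' : MrlexGt a b c d v w) :
    MrlexGt a b c d u w := by
  have hv : v ∈ BM a b → v ∉ BN b c d := not_mem_BN_of_mem_BM hab
  have ht : RlexGt u v → RlexGt v w → RlexGt u w := RlexGt.trans
  simp only [MrlexGt] at *
  tauto

theorem HTVarGt.irrefl {n : ℕ} {a₂ b₂ c₂ d₂ : Fin n} (h22 : a₂ ≤ b₂)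
    {S₁ S₂ : Set (Fin n →₀ ℕ)} (v : ↥S₁ ⊕ ↥S₂) : ¬ HTVarGt a₂ b₂ c₂ d₂ S₁ S₂ v v := by
  rcases v with v | v
  · exact RlexGt.irrefl _
  · exact MrlexGt.irrefl h22 _

theorem HTVarGt.trans {n : ℕ} {a₂ b₂ c₂ d₂ : Fin n} (h22 : a₂ ≤ b₂)
    {S₁ S₂ : Set (Fin n →₀ ℕ)} {u v w : ↥S₁ ⊕ ↥S₂} (h : HTVarGt a₂ b₂ c₂ d₂ S₁ S₂ u v)
    (h' : HTVarGt a₂ b₂ c₂ d₂ S₁ S₂ v w) : HTVarGt a₂ b₂ c₂ d₂ S₁ S₂ u w := by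
  rcases u with u | u <;> rcases v with v | v <;> rcases w with w | w
  · exact RlexGt.trans h h'
  · trivial
  · exact h'.elim
  · trivial
  · exact h.elim
  · exact h.elim
  · exact h'.elim
  · exact MrlexGt.trans h22 h h'

theorem HTVarGt.total {n : ℕ} {a₁ b₁ c₁ d₁ a₂ b₂ c₂ d₂ : Fin n} (h22 : a₂ ≤ b₂)
    {v w : ↥(BM a₁ b₁ ∪ BN b₁ c₁ d₁) ⊕ ↥(BM a₂ b₂ ∪ BN b₂ c₂ d₂)} (hne : v ≠ w) :
    HTVarGt a₂ b₂ c₂ d₂ _ _ v w ∨ HTVarGt a₂ b₂ c₂ d₂ _ _ w v := by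
  rcases v with ⟨v, hv⟩ | ⟨v, hv⟩ <;> rcases w with ⟨w, hw⟩ | ⟨w, hw⟩
  · obtain ⟨i, j, -, rfl⟩ := exists_quad_of_mem hv
    obtain ⟨k, l, -, rfl⟩ := exists_quad_of_mem hw
    rcases pairRlex_or_quad_eq i j k l with h | h | h
    · exact Or.inl (rlexGt_quad_iff.mpr h)
    · exact absurd (congrArg Sum.inl (Subtype.ext h)) hne
    · exact Or.inr (rlexGt_quad_iff.mpr h)
  · exact Or.inl trivial
  · exact Or.inr trivial
  · obtain ⟨i, j, -, rfl⟩ := exists_quad_of_mem hv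
    obtain ⟨k, l, -, rfl⟩ := exists_quad_of_mem hw
    have h := pairRlex_or_quad_eq i j k l
    have hne' : quad i j ≠ quad k l := fun h => hne (congrArg Sum.inr (Subtype.ext h))
    rw [quad_mem_iff h22, PairIn] at hv hw
    change MrlexGt a₂ b₂ c₂ d₂ (quad i j) (quad k l) ∨ MrlexGt a₂ b₂ c₂ d₂ (quad k l) (quad i j)
    rw [mrlexGt_quad_iff h22, mrlexGt_quad_iff h22]
    tauto

theorem VarRevlexGt.irrefl {V : Type*} (vgt : V → V → Prop) (m : V →₀ ℕ) :
    ¬ VarRevlexGt vgt m m := by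
  rintro (h | ⟨-, k, h, -⟩) <;> exact lt_irrefl _ h

/-- A quadratic monomial both of whose factors are greater than a factor of another quadratic
monomial is the greater of the two. -/
theorem varRevlexGt_single_add_single {V : Type*} {vgt : V → V → Prop} (irrefl : ∀ v, ¬ vgt v v)
    (trans : ∀ {u v w}, vgt u v → vgt v w → vgt u w) {u v u' v' : V}
    (hu : vgt u v') (hv : vgt v v') :
    VarRevlexGt vgt (Finsupp.single u 1 + Finsupp.single v 1)
      (Finsupp.single u' 1 + Finsupp.single v' 1) := by
  classical
  refine Or.inr ⟨?_, ?_⟩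
  · simp [Finsupp.sum_add_index']
  · have aux : ∀ k, vgt u k → vgt v k → (u' = k ∨ v' = k) →
        (∀ l, vgt k l → u' ≠ l ∧ v' ≠ l) →
        ∃ k, (Finsupp.single u 1 + Finsupp.single v 1 : V →₀ ℕ) k <
            (Finsupp.single u' 1 + Finsupp.single v' 1 : V →₀ ℕ) k ∧
          ∀ l, vgt k l → (Finsupp.single u 1 + Finsupp.single v 1 : V →₀ ℕ) l =
            (Finsupp.single u' 1 + Finsupp.single v' 1 : V →₀ ℕ) l := by
      intro k huk hvk hk hl
      have huk' : u ≠ k := fun h => irrefl k (h ▸ huk)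
      have hvk' : v ≠ k := fun h => irrefl k (h ▸ hvk)
      refine ⟨k, ?_, fun l hkl => ?_⟩
      · simp only [Finsupp.add_apply, Finsupp.single_apply, if_neg huk', if_neg hvk']
        rcases hk with hk | hk <;> simp [hk]
      · have hul : u ≠ l := fun h => irrefl k (trans hkl (h ▸ huk))
        have hvl : v ≠ l := fun h => irrefl k (trans hkl (h ▸ hvk))
        simp [Finsupp.single_apply, if_neg hul, if_neg hvl, if_neg (hl l hkl).1,
          if_neg (hl l hkl).2]
    by_cases h : vgt v' u'
    · exact aux u' (trans hu h) (trans hv h) (Or.inl rfl)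
        fun l hl => ⟨fun e => irrefl l (e ▸ hl), fun e => irrefl l (trans (e ▸ h) hl)⟩
    · exact aux v' hu hv (Or.inr rfl)
        fun l hl => ⟨fun e => h (e ▸ hl), fun e => irrefl l (e ▸ hl)⟩

/-- The total weight of a monomial whose variables carry the weights `g`. -/
noncomputable def weightHom {V : Type*} (g : V → ℤ) : (V →₀ ℕ) →+ ℤ :=
  Finsupp.liftAddHom fun v => multiplesHom ℤ (g v)

theorem weightHom_single {V : Type*} (g : V → ℤ) (v : V) (k : ℕ) :
    weightHom g (Finsupp.single v k) = k * g v := by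
  simp [weightHom]

theorem weightHom_eq_sum {V : Type*} (g : V → ℤ) (m : V →₀ ℕ) :
    weightHom g m = m.sum fun v e => e * g v := by
  simp [weightHom, Finsupp.sum, multiplesHom_apply]

theorem weightHom_fiberMap {V W : Type*} (u : V → (W →₀ ℕ)) (g : W → ℤ) (m : V →₀ ℕ) :
    weightHom g (fiberMap u m) = weightHom (fun v => weightHom g (u v)) m := by
  rw [fiberMap, map_finsuppSum, weightHom_eq_sum]
  simp

theorem weightHom_nonneg {V : Type*} {g : V → ℤ} {m : V →₀ ℕ} (h : ∀ v, m v ≠ 0 → 0 ≤ g v) :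
    0 ≤ weightHom g m := by
  rw [weightHom_eq_sum]
  exact Finset.sum_nonneg fun v hv =>
    mul_nonneg (Int.natCast_nonneg _) (h v (Finsupp.mem_support_iff.mp hv))

theorem weightHom_nonpos {V : Type*} {g : V → ℤ} {m : V →₀ ℕ} (h : ∀ v, m v ≠ 0 → g v ≤ 0) :
    weightHom g m ≤ 0 := by
  rw [weightHom_eq_sum]
  exact Finset.sum_nonpos fun v hv =>
    mul_nonpos_of_nonneg_of_nonpos (Int.natCast_nonneg _) (h v (Finsupp.mem_support_iff.mp hv))

theorem single_add_tsub_of_ne_zero {V : Type*} {m : V →₀ ℕ} {v : V} (h : m v ≠ 0) :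
    Finsupp.single v 1 + (m - Finsupp.single v 1) = m :=
  add_tsub_cancel_of_le (Finsupp.single_le_iff.mpr (Nat.one_le_iff_ne_zero.mpr h))

theorem weightHom_eq_add_tsub {V : Type*} (g : V → ℤ) {m : V →₀ ℕ} {v : V} (h : m v ≠ 0) :
    weightHom g m = g v + weightHom g (m - Finsupp.single v 1) := by
  conv_lhs => rw [← single_add_tsub_of_ne_zero h, map_add, weightHom_single]
  simp

theorem ne_zero_of_single_add_le {V : Type*} {m : V →₀ ℕ} {v u : V}
    (h : Finsupp.single v 1 + Finsupp.single u 1 ≤ m) : m u ≠ 0 := by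
  have := h u
  simp only [Finsupp.add_apply, Finsupp.single_eq_same] at this
  omega

theorem single_add_single_le_of_tsub {V : Type*} {m : V →₀ ℕ} {v w : V} (hv : m v ≠ 0)
    (hw : (m - Finsupp.single v 1 : V →₀ ℕ) w ≠ 0) : Finsupp.single v 1 + Finsupp.single w 1 ≤ m := by
  rw [← single_add_tsub_of_ne_zero hv]
  gcongr
  exact Finsupp.single_le_iff.mpr (Nat.one_le_iff_ne_zero.mpr hw)

theorem single_add_single_le_of_ne {V : Type*} {m : V →₀ ℕ} {v w : V} (hv : m v ≠ 0)
    (hw : m w ≠ 0) (hne : v ≠ w) : Finsupp.single v 1 + Finsupp.single w 1 ≤ m :=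
  single_add_single_le_of_tsub hv (by
    classical simpa [Finsupp.single_apply, hne] using hw)

/-- A nonnegative weight which is positive somewhere on one monomial is positive somewhere on any
monomial of the same weight. -/
theorem exists_weight_pos {V : Type*} {g : V → ℤ} {m m' : V →₀ ℕ}
    (heq : weightHom g m = weightHom g m') (hg : ∀ v, 0 ≤ g v) {w : V} (hw : m' w ≠ 0)
    (hpos : 0 < g w) : ∃ v, m v ≠ 0 ∧ 0 < g v := by
  by_contra! hall
  have := weightHom_nonpos hall
  have := weightHom_eq_add_tsub g hw
  have := weightHom_nonneg (m := m' - Finsupp.single w 1) fun v _ => hg v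
  omega

/-- If a factor of one monomial has smaller nonnegative weight than a factor of another monomial
of the same total weight, then it has a cofactor of positive weight. -/
theorem exists_cofactor_weight_pos {V : Type*} {g : V → ℤ} {m m' : V →₀ ℕ}
    (heq : weightHom g m = weightHom g m') (hg : ∀ v, 0 ≤ g v) {v w : V} (hv : m v ≠ 0)
    (hw : m' w ≠ 0) (hlt : g v < g w) :
    ∃ u, Finsupp.single v 1 + Finsupp.single u 1 ≤ m ∧ 0 < g u := by
  by_contra! hall
  have := weightHom_eq_add_tsub g hv
  have := weightHom_eq_add_tsub g hw
  have := weightHom_nonneg (m := m' - Finsupp.single w 1) fun v _ => hg v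
  have := weightHom_nonpos (m := m - Finsupp.single v 1)
    fun u hu => hall u (single_add_single_le_of_tsub hv hu)
  omega

/-- A nonpositive weight takes on each factor at least the value of the whole monomial. -/
theorem weightHom_le {V : Type*} {g : V → ℤ} {m : V →₀ ℕ} (hg : ∀ v, g v ≤ 0) {w : V}
    (hw : m w ≠ 0) : weightHom g m ≤ g w := by
  have := weightHom_eq_add_tsub g hw
  have := weightHom_nonpos (m := m - Finsupp.single w 1) fun v _ => hg v
  omega

theorem PairIn.of_le {a b c d x y x' : ℕ} (hca : c < a) (h : PairIn a b c d x y) (hx : x' ≤ x) :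
    PairIn a b c d x' y := by
  simp only [PairIn, PairBM, PairBN] at *
  omega

/-- The monomial underlying a variable `T_u` or `Z_u`, tagged by the type of the variable. -/
def baseMonomial {n : ℕ} {S₁ S₂ : Set (Fin n →₀ ℕ)} (v : ↥S₁ ⊕ ↥S₂) :
    (Fin n →₀ ℕ) ⊕ (Fin n →₀ ℕ) :=
  Sum.map Subtype.val Subtype.val v

theorem baseMonomial_injective {n : ℕ} {S₁ S₂ : Set (Fin n →₀ ℕ)} :
    Function.Injective (baseMonomial : ↥S₁ ⊕ ↥S₂ → _) :=
  Sum.map_injective.mpr ⟨Subtype.val_injective, Subtype.val_injective⟩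

theorem exists_baseMonomial_eq {n : ℕ} {a₁ b₁ c₁ d₁ a₂ b₂ c₂ d₂ : Fin n}
    (v : ↥(BM a₁ b₁ ∪ BN b₁ c₁ d₁) ⊕ ↥(BM a₂ b₂ ∪ BN b₂ c₂ d₂)) :
    ∃ x y : Fin n, x ≤ y ∧
      (baseMonomial v = Sum.inl (quad x y) ∨ baseMonomial v = Sum.inr (quad x y)) := by
  rcases v with ⟨v, hv⟩ | ⟨v, hv⟩ <;> obtain ⟨x, y, hxy, rfl⟩ := exists_quad_of_mem hv
  · exact ⟨x, y, hxy, Or.inl rfl⟩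
  · exact ⟨x, y, hxy, Or.inr rfl⟩

theorem mem_of_baseMonomial_eq_inl {n : ℕ} {S₁ S₂ : Set (Fin n →₀ ℕ)} {v : ↥S₁ ⊕ ↥S₂}
    {u : Fin n →₀ ℕ} (h : baseMonomial v = Sum.inl u) : ∃ hu : u ∈ S₁, v = Sum.inl ⟨u, hu⟩ := by
  rcases v with ⟨v, hv⟩ | ⟨v, hv⟩
  · obtain rfl : v = u := Sum.inl_injective h
    exact ⟨hv, rfl⟩
  · exact absurd h (by simp [baseMonomial])

theorem mem_of_baseMonomial_eq_inr {n : ℕ} {S₁ S₂ : Set (Fin n →₀ ℕ)} {v : ↥S₁ ⊕ ↥S₂}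
    {u : Fin n →₀ ℕ} (h : baseMonomial v = Sum.inr u) : ∃ hu : u ∈ S₂, v = Sum.inr ⟨u, hu⟩ := by
  rcases v with ⟨v, hv⟩ | ⟨v, hv⟩
  · exact absurd h (by simp [baseMonomial])
  · obtain rfl : v = u := Sum.inr_injective h
    exact ⟨hv, rfl⟩

/-- The weight of a variable when `x_i` has weight `f i` and `t`, `z` have weights `A`, `B`. -/
noncomputable def varWeight {n : ℕ} (S₁ S₂ : Set (Fin n →₀ ℕ)) (f : ℕ → ℤ) (A B : ℤ)
    (v : ↥S₁ ⊕ ↥S₂) : ℤ :=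
  weightHom (Sum.elim (fun i : Fin n => f i) ![A, B]) (TZexp S₁ S₂ v)

theorem varWeight_of_inl {n : ℕ} {S₁ S₂ : Set (Fin n →₀ ℕ)} (f : ℕ → ℤ) (A B : ℤ)
    {v : ↥S₁ ⊕ ↥S₂} {x y : Fin n} (h : baseMonomial v = Sum.inl (quad x y)) :
    varWeight S₁ S₂ f A B v = f x + f y + A := by
  obtain ⟨hu, rfl⟩ := mem_of_baseMonomial_eq_inl h
  simp [varWeight, TZexp, quad, Finsupp.mapDomain_add, Finsupp.mapDomain_single,
    weightHom_single]

theorem varWeight_of_inr {n : ℕ} {S₁ S₂ : Set (Fin n →₀ ℕ)} (f : ℕ → ℤ) (A B : ℤ)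
    {v : ↥S₁ ⊕ ↥S₂} {x y : Fin n} (h : baseMonomial v = Sum.inr (quad x y)) :
    varWeight S₁ S₂ f A B v = f x + f y + B := by
  obtain ⟨hu, rfl⟩ := mem_of_baseMonomial_eq_inr h
  simp [varWeight, TZexp, quad, Finsupp.mapDomain_add, Finsupp.mapDomain_single,
    weightHom_single]

/-- The multiplicity of the index `k` in a variable. -/
noncomputable def indexCount {n : ℕ} (S₁ S₂ : Set (Fin n →₀ ℕ)) (k : Fin n) :
    ↥S₁ ⊕ ↥S₂ → ℤ :=
  varWeight S₁ S₂ (fun x => if x = (k : ℕ) then 1 else 0) 0 0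

theorem indexCount_nonneg {n : ℕ} {a₁ b₁ c₁ d₁ a₂ b₂ c₂ d₂ : Fin n} (k : Fin n)
    (v : ↥(BM a₁ b₁ ∪ BN b₁ c₁ d₁) ⊕ ↥(BM a₂ b₂ ∪ BN b₂ c₂ d₂)) : 0 ≤ indexCount _ _ k v := by
  obtain ⟨x, y, -, h | h⟩ := exists_baseMonomial_eq v
  · rw [indexCount, varWeight_of_inl _ _ _ h]
    split_ifs <;> simp
  · rw [indexCount, varWeight_of_inr _ _ _ h]
    split_ifs <;> simp

theorem exists_of_indexCount_pos {n : ℕ} {a₁ b₁ c₁ d₁ a₂ b₂ c₂ d₂ : Fin n} {k : Fin n}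
    {v : ↥(BM a₁ b₁ ∪ BN b₁ c₁ d₁) ⊕ ↥(BM a₂ b₂ ∪ BN b₂ c₂ d₂)} (hv : 0 < indexCount _ _ k v) :
    ∃ l : Fin n, baseMonomial v = Sum.inl (quad k l) ∨ baseMonomial v = Sum.inr (quad k l) := by
  obtain ⟨x, y, -, h⟩ := exists_baseMonomial_eq v
  have hk : k = x ∨ k = y := by
    by_contra! hne
    have hx : (x : ℕ) ≠ k := fun e => hne.1 (Fin.ext e.symm)
    have hy : (y : ℕ) ≠ k := fun e => hne.2 (Fin.ext e.symm)
    rcases h with h | h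
    · simp [indexCount, varWeight_of_inl _ _ _ h, hx, hy] at hv
    · simp [indexCount, varWeight_of_inr _ _ _ h, hx, hy] at hv
  rcases hk with rfl | rfl
  · exact ⟨y, h⟩
  · exact ⟨x, by rwa [quad_comm]⟩

/-- Two monomials `m`, `m'` in the same fiber such that no marked term divides `m` and the variable
`w` divides `m'` and is smaller than every variable dividing `m`. -/
structure IrreducibleAbove {n : ℕ} (a₁ b₁ c₁ d₁ a₂ b₂ c₂ d₂ : Fin n)
    (m m' : ↥(BM a₁ b₁ ∪ BN b₁ c₁ d₁) ⊕ ↥(BM a₂ b₂ ∪ BN b₂ c₂ d₂) →₀ ℕ)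
    (w : ↥(BM a₁ b₁ ∪ BN b₁ c₁ d₁) ⊕ ↥(BM a₂ b₂ ∪ BN b₂ c₂ d₂)) : Prop where
  ca₁ : c₁ < a₁
  ab₁ : a₁ ≤ b₁
  bd₁ : b₁ < d₁
  ca₂ : c₂ < a₂
  ab₂ : a₂ ≤ b₂
  dd : d₁ ≤ d₂
  fiber_eq : fiberMap (TZexp _ _) m = fiberMap (TZexp _ _) m'
  pos : m' w ≠ 0
  gt : ∀ {v}, m v ≠ 0 → HTVarGt a₂ b₂ c₂ d₂ _ _ v w
  not_head_le : ∀ g ∈ GHT a₁ b₁ c₁ d₁ a₂ b₂ c₂ d₂, ¬ g.head ≤ m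

namespace IrreducibleAbove

variable {n : ℕ} {a₁ b₁ c₁ d₁ a₂ b₂ c₂ d₂ : Fin n}
  {m m' : ↥(BM a₁ b₁ ∪ BN b₁ c₁ d₁) ⊕ ↥(BM a₂ b₂ ∪ BN b₂ c₂ d₂) →₀ ℕ}
  {v u w : ↥(BM a₁ b₁ ∪ BN b₁ c₁ d₁) ⊕ ↥(BM a₂ b₂ ∪ BN b₂ c₂ d₂)}
  {x y x' y' p q r s i j : Fin n}

theorem weight_eq (C : IrreducibleAbove a₁ b₁ c₁ d₁ a₂ b₂ c₂ d₂ m m' w) (f : ℕ → ℤ) (A B : ℤ) :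
    weightHom (varWeight _ _ f A B) m = weightHom (varWeight _ _ f A B) m' := by
  have := congrArg (weightHom (Sum.elim (fun i : Fin n => f i) ![A, B])) C.fiber_eq
  rwa [weightHom_fiberMap, weightHom_fiberMap] at this

theorem pairIn_of_inl (C : IrreducibleAbove a₁ b₁ c₁ d₁ a₂ b₂ c₂ d₂ m m' w)
    (h : baseMonomial v = Sum.inl (quad x y)) : PairIn a₁ b₁ c₁ d₁ x y :=
  (quad_mem_iff C.ab₁).mp (mem_of_baseMonomial_eq_inl h).1

theorem pairIn_of_inr (C : IrreducibleAbove a₁ b₁ c₁ d₁ a₂ b₂ c₂ d₂ m m' w)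
    (h : baseMonomial v = Sum.inr (quad x y)) : PairIn a₂ b₂ c₂ d₂ x y :=
  (quad_mem_iff C.ab₂).mp (mem_of_baseMonomial_eq_inr h).1

theorem gt_inl (C : IrreducibleAbove a₁ b₁ c₁ d₁ a₂ b₂ c₂ d₂ m m' w) (hv : m v ≠ 0)
    (h : baseMonomial v = Sum.inl (quad x y)) (hw : baseMonomial w = Sum.inl (quad i j)) :
    PairRlex x y i j := by
  have hgt := C.gt hv
  obtain ⟨_, rfl⟩ := mem_of_baseMonomial_eq_inl h
  obtain ⟨_, rfl⟩ := mem_of_baseMonomial_eq_inl hw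
  exact rlexGt_quad_iff.mp hgt

theorem gt_inr (C : IrreducibleAbove a₁ b₁ c₁ d₁ a₂ b₂ c₂ d₂ m m' w) (hv : m v ≠ 0)
    (h : baseMonomial v = Sum.inr (quad x y)) (hw : baseMonomial w = Sum.inr (quad i j)) :
    MrlexGt a₂ b₂ c₂ d₂ (quad x y) (quad i j) := by
  have hgt := C.gt hv
  obtain ⟨_, rfl⟩ := mem_of_baseMonomial_eq_inr h
  obtain ⟨_, rfl⟩ := mem_of_baseMonomial_eq_inr hw
  exact hgt

theorem not_inr_of_inl (C : IrreducibleAbove a₁ b₁ c₁ d₁ a₂ b₂ c₂ d₂ m m' w) (hv : m v ≠ 0)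
    (h : baseMonomial v = Sum.inr (quad x y)) (hw : baseMonomial w = Sum.inl (quad i j)) :
    False := by
  have hgt := C.gt hv
  obtain ⟨_, rfl⟩ := mem_of_baseMonomial_eq_inr h
  obtain ⟨_, rfl⟩ := mem_of_baseMonomial_eq_inl hw
  exact hgt

theorem not_swap_T_T (C : IrreducibleAbove a₁ b₁ c₁ d₁ a₂ b₂ c₂ d₂ m m' w)
    (hle : Finsupp.single v 1 + Finsupp.single u 1 ≤ m)
    (hv : baseMonomial v = Sum.inl (quad x y)) (hu : baseMonomial u = Sum.inl (quad x' y'))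
    (hpq : PairIn a₁ b₁ c₁ d₁ p q) (hrs : PairIn a₁ b₁ c₁ d₁ r s)
    (hsum : quad x y + quad x' y' = quad p q + quad r s)
    (hgt : PairRlex x y r s) (hgt' : PairRlex x' y' r s) : False := by
  obtain ⟨hxy, rfl⟩ := mem_of_baseMonomial_eq_inl hv
  obtain ⟨hxy', rfl⟩ := mem_of_baseMonomial_eq_inl hu
  rw [← quad_mem_iff C.ab₁] at hpq hrs
  refine C.not_head_le _ (Or.inl (Or.inl ⟨⟨_, _⟩, ⟨⟨_, hxy⟩, ⟨_, hxy'⟩, ⟨_, hpq⟩, ⟨_, hrs⟩, hsum,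
    rlexGt_quad_iff.mpr hgt, rlexGt_quad_iff.mpr hgt', rfl, rfl⟩, rfl⟩)) ?_
  simpa only [MarkedBinomial.map, Finsupp.mapDomain_add, Finsupp.mapDomain_single] using hle

theorem not_swap_Z_Z (C : IrreducibleAbove a₁ b₁ c₁ d₁ a₂ b₂ c₂ d₂ m m' w)
    (hle : Finsupp.single v 1 + Finsupp.single u 1 ≤ m)
    (hv : baseMonomial v = Sum.inr (quad x y)) (hu : baseMonomial u = Sum.inr (quad x' y'))
    (hpq : PairIn a₂ b₂ c₂ d₂ p q) (hrs : PairIn a₂ b₂ c₂ d₂ r s)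
    (hsum : quad x y + quad x' y' = quad p q + quad r s)
    (hgt : MrlexGt a₂ b₂ c₂ d₂ (quad x y) (quad r s))
    (hgt' : MrlexGt a₂ b₂ c₂ d₂ (quad x' y') (quad r s)) : False := by
  obtain ⟨hxy, rfl⟩ := mem_of_baseMonomial_eq_inr hv
  obtain ⟨hxy', rfl⟩ := mem_of_baseMonomial_eq_inr hu
  rw [← quad_mem_iff C.ab₂] at hpq hrs
  refine C.not_head_le _ (Or.inl (Or.inr ⟨⟨_, _⟩, ⟨⟨_, hxy⟩, ⟨_, hxy'⟩, ⟨_, hpq⟩, ⟨_, hrs⟩, hsum,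
    hgt, hgt', rfl, rfl⟩, rfl⟩)) ?_
  simpa only [MarkedBinomial.map, Finsupp.mapDomain_add, Finsupp.mapDomain_single] using hle

theorem not_swap_T_Z (C : IrreducibleAbove a₁ b₁ c₁ d₁ a₂ b₂ c₂ d₂ m m' w)
    (hvm : m v ≠ 0) (hum : m u ≠ 0)
    (hv : baseMonomial v = Sum.inl (quad x y)) (hu : baseMonomial u = Sum.inr (quad x' y'))
    (hpq : PairIn a₁ b₁ c₁ d₁ p q) (hrs : PairIn a₂ b₂ c₂ d₂ r s)
    (hsum : quad x y + quad x' y' = quad p q + quad r s)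
    (hgt : MrlexGt a₂ b₂ c₂ d₂ (quad x' y') (quad r s)) : False := by
  obtain ⟨hxy, rfl⟩ := mem_of_baseMonomial_eq_inl hv
  obtain ⟨hxy', rfl⟩ := mem_of_baseMonomial_eq_inr hu
  rw [← quad_mem_iff C.ab₁] at hpq
  rw [← quad_mem_iff C.ab₂] at hrs
  exact C.not_head_le ⟨_, _⟩ (Or.inr ⟨⟨_, hxy⟩, ⟨_, hpq⟩, ⟨_, hxy'⟩, ⟨_, hrs⟩, hsum, hgt, rfl, rfl⟩)
    (single_add_single_le_of_ne hvm hum (by simp))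

/-- Some factor of `m` involves any index involved in `w`. -/
theorem exists_index (C : IrreducibleAbove a₁ b₁ c₁ d₁ a₂ b₂ c₂ d₂ m m' w)
    (hw : baseMonomial w = Sum.inl (quad i j) ∨ baseMonomial w = Sum.inr (quad i j)) :
    ∃ v, m v ≠ 0 ∧
      ∃ l, baseMonomial v = Sum.inl (quad j l) ∨ baseMonomial v = Sum.inr (quad j l) := by
  obtain ⟨v, hv, hpos⟩ := exists_weight_pos (g := indexCount _ _ j) (C.weight_eq _ _ _)
    (indexCount_nonneg j) C.pos (by
      rcases hw with hw | hw
      · rw [indexCount, varWeight_of_inl _ _ _ hw]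
        split_ifs <;> simp_all
      · rw [indexCount, varWeight_of_inr _ _ _ hw]
        split_ifs <;> simp_all)
  exact ⟨v, hv, exists_of_indexCount_pos hpos⟩

/-- A factor of the type of `w`, sharing the index `j` with `w` and whose other index `p` is less
than the other index `i` of `w`, has a cofactor involving `i`. -/
theorem exists_cofactor_index (C : IrreducibleAbove a₁ b₁ c₁ d₁ a₂ b₂ c₂ d₂ m m' w)
    (hw : baseMonomial w = Sum.inl (quad i j) ∨ baseMonomial w = Sum.inr (quad i j))
    (hv : baseMonomial v = Sum.inl (quad p j) ∨ baseMonomial v = Sum.inr (quad p j))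
    (hvm : m v ≠ 0) (hpi : p < i) :
    ∃ u, Finsupp.single v 1 + Finsupp.single u 1 ≤ m ∧
      ∃ l, baseMonomial u = Sum.inl (quad i l) ∨ baseMonomial u = Sum.inr (quad i l) := by
  obtain ⟨u, hu, hpos⟩ := exists_cofactor_weight_pos (g := indexCount _ _ i) (C.weight_eq _ _ _)
    (indexCount_nonneg i) hvm C.pos (by
      have hwi : indexCount _ _ i w = 1 + if (j : ℕ) = i then 1 else 0 := by
        rcases hw with hw | hw
        · simp [indexCount, varWeight_of_inl _ _ _ hw]
        · simp [indexCount, varWeight_of_inr _ _ _ hw]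
      have hpi' : (p : ℕ) ≠ i := by omega
      have hvi : indexCount _ _ i v = if (j : ℕ) = i then 1 else 0 := by
        rcases hv with hv | hv
        · simp [indexCount, varWeight_of_inl _ _ _ hv, hpi']
        · simp [indexCount, varWeight_of_inr _ _ _ hv, hpi']
      omega)
  exact ⟨u, hu, exists_of_indexCount_pos hpos⟩

theorem not_T_of_lt (C : IrreducibleAbove a₁ b₁ c₁ d₁ a₂ b₂ c₂ d₂ m m' w)
    (hw : baseMonomial w = Sum.inl (quad i j)) (hv : baseMonomial v = Sum.inl (quad p j))
    (hvm : m v ≠ 0) (hpi : p < i) : False := by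
  obtain ⟨u, hle, l, hu | hu⟩ := C.exists_cofactor_index (Or.inl hw) (Or.inl hv) hvm hpi
  · refine C.not_swap_T_T hle hv hu ((C.pairIn_of_inl hu).of_le C.ca₁ hpi.le) (C.pairIn_of_inl hw)
      ?_ (C.gt_inl hvm hv hw) (C.gt_inl (ne_zero_of_single_add_le hle) hu hw)
    simp only [quad]
    abel
  · exact C.not_inr_of_inl (ne_zero_of_single_add_le hle) hu hw

theorem not_Z_of_lt (C : IrreducibleAbove a₁ b₁ c₁ d₁ a₂ b₂ c₂ d₂ m m' w)
    (hw : baseMonomial w = Sum.inr (quad i j)) (hv : baseMonomial v = Sum.inr (quad p j))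
    (hvm : m v ≠ 0) (hpi : p < i) : False := by
  obtain ⟨u, hle, l, hu | hu⟩ := C.exists_cofactor_index (Or.inr hw) (Or.inr hv) hvm hpi
  · refine C.not_swap_T_Z (ne_zero_of_single_add_le hle) hvm hu hv
      ((C.pairIn_of_inl hu).of_le C.ca₁ hpi.le) (C.pairIn_of_inr hw) ?_ (C.gt_inr hvm hv hw)
    simp only [quad]
    abel
  · refine C.not_swap_Z_Z hle hv hu ((C.pairIn_of_inr hu).of_le C.ca₂ hpi.le) (C.pairIn_of_inr hw)
      ?_ (C.gt_inr hvm hv hw) (C.gt_inr (ne_zero_of_single_add_le hle) hu hw)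
    simp only [quad]
    abel

theorem not_inl (C : IrreducibleAbove a₁ b₁ c₁ d₁ a₂ b₂ c₂ d₂ m m' w) (hij : i ≤ j)
    (hw : baseMonomial w = Sum.inl (quad i j)) : False := by
  obtain ⟨v, hvm, q, hv | hv⟩ := C.exists_index (Or.inl hw)
  · have hgt := C.gt_inl hvm hv hw
    rw [quad_comm] at hv
    refine C.not_T_of_lt hw hv hvm ?_
    simp only [PairRlex] at hgt
    omega
  · exact C.not_inr_of_inl hvm hv hw

/-- Some `Z`-variable divides `m` if `w` is a `Z`-variable. -/
theorem exists_Z (C : IrreducibleAbove a₁ b₁ c₁ d₁ a₂ b₂ c₂ d₂ m m' w)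
    (hw : baseMonomial w = Sum.inr (quad i j)) :
    ∃ v, m v ≠ 0 ∧ ∃ p q, p ≤ q ∧ baseMonomial v = Sum.inr (quad p q) := by
  obtain ⟨v, hvm, hpos⟩ := exists_weight_pos (C.weight_eq 0 0 1)
    (fun v => by
      obtain ⟨x, y, -, h | h⟩ := exists_baseMonomial_eq v
      · simp [varWeight_of_inl _ _ _ h]
      · simp [varWeight_of_inr _ _ _ h]) C.pos (by simp [varWeight_of_inr _ _ _ hw])
  obtain ⟨x, y, hxy, h | h⟩ := exists_baseMonomial_eq v
  · simp [varWeight_of_inl _ _ _ h] at hpos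
  · exact ⟨v, hvm, x, y, hxy, h⟩

theorem mrlexGt_iff (C : IrreducibleAbove a₁ b₁ c₁ d₁ a₂ b₂ c₂ d₂ m m' w) :
    MrlexGt a₂ b₂ c₂ d₂ (quad x y) (quad p q) ↔
      (PairBN b₂ c₂ d₂ x y ∧ PairBM a₂ b₂ p q) ∨
        (PairBM a₂ b₂ x y ∧ PairBM a₂ b₂ p q ∧ PairRlex x y p q) ∨
          (PairBN b₂ c₂ d₂ x y ∧ PairBN b₂ c₂ d₂ p q ∧ PairRlex x y p q) :=
  mrlexGt_quad_iff C.ab₂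

theorem not_inr_BN (C : IrreducibleAbove a₁ b₁ c₁ d₁ a₂ b₂ c₂ d₂ m m' w) (hij : i ≤ j)
    (hw : baseMonomial w = Sum.inr (quad i j)) (hbn : PairBN b₂ c₂ d₂ i j) : False := by
  have hca := C.ca₂
  have hab := C.ab₂
  have hZ : ∀ {v p q}, m v ≠ 0 → baseMonomial v = Sum.inr (quad p q) →
      PairBN b₂ c₂ d₂ p q ∧ PairRlex p q i j := by
    intro v p q hvm hv
    have hgt := C.mrlexGt_iff.mp (C.gt_inr hvm hv hw)
    simp only [PairBM, PairBN, PairRlex] at *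
    omega
  obtain ⟨v, hvm, l, hv | hv⟩ := C.exists_index (Or.inr hw)
  · obtain ⟨u, hum, p, q, hpq, hu⟩ := C.exists_Z hw
    obtain ⟨hbn', hgt⟩ := hZ hum hu
    rcases eq_or_ne q j with rfl | hqj
    · refine C.not_Z_of_lt hw hu hum ?_
      simp only [PairRlex] at hgt
      omega
    · have hlt : q < j := by
        simp only [PairRlex] at hgt
        omega
      refine C.not_swap_T_Z hvm hum hv hu (p := q) (q := l) (r := p) (s := j)
        ((C.pairIn_of_inl hv).of_le C.ca₁ hlt.le) ?_ ?_ (C.mrlexGt_iff.mpr ?_)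
      · simp only [PairIn, PairBM, PairBN] at *
        omega
      · simp only [quad]
        abel
      · simp only [PairBM, PairBN, PairRlex] at *
        omega
  · have hgt := (hZ hvm hv).2
    rw [quad_comm] at hv
    refine C.not_Z_of_lt hw hv hvm ?_
    simp only [PairRlex] at hgt
    omega

theorem not_inr_BM (C : IrreducibleAbove a₁ b₁ c₁ d₁ a₂ b₂ c₂ d₂ m m' w) (hij : i ≤ j)
    (hw : baseMonomial w = Sum.inr (quad i j)) (hbm : PairBM a₂ b₂ i j) (hpq : p ≤ q)
    (hvm : m v ≠ 0) (hv : baseMonomial v = Sum.inr (quad p q)) (hbm' : PairBM a₂ b₂ p q) :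
    False := by
  have hca := C.ca₂
  have hab := C.ab₂
  have hgt := C.mrlexGt_iff.mp (C.gt_inr hvm hv hw)
  have hgt' : PairRlex p q i j := by
    simp only [PairBM, PairBN, PairRlex] at *
    omega
  clear hgt
  rcases eq_or_ne q j with rfl | hqj
  · refine C.not_Z_of_lt hw hv hvm ?_
    simp only [PairRlex] at hgt'
    omega
  have hlt : q < j := by
    simp only [PairRlex] at hgt'
    omega
  obtain ⟨u, hum, l, hu | hu⟩ := C.exists_index (Or.inr hw)
  · refine C.not_swap_T_Z hum hvm hu hv (p := q) (q := l) (r := p) (s := j)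
      ((C.pairIn_of_inl hu).of_le C.ca₁ hlt.le) ?_ ?_ (C.mrlexGt_iff.mpr ?_)
    · simp only [PairIn, PairBM, PairBN] at *
      omega
    · simp only [quad]
      abel
    · simp only [PairBM, PairBN, PairRlex] at *
      omega
  · have hgtu : PairBM a₂ b₂ j l → PairRlex j l i j := by
      have := C.mrlexGt_iff.mp (C.gt_inr hum hu hw)
      clear hgt' hlt hqj
      simp only [PairBM, PairBN, PairRlex] at *
      omega
    by_cases hbmu : PairBM a₂ b₂ j l
    · have hgtu := hgtu hbmu
      rw [quad_comm] at hu
      refine C.not_Z_of_lt hw hu hum ?_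
      simp only [PairRlex] at hgtu
      omega
    · have hbnu := (C.pairIn_of_inr hu).resolve_left hbmu
      have hvu : v ≠ u := by
        rintro rfl
        rw [hv, Sum.inr.injEq, quad_eq_quad_iff] at hu
        clear hgt' hgtu hbm
        simp only [PairBM, PairBN, Fin.ext_iff] at *
        omega
      clear hgtu
      have hpj : PairBM a₂ b₂ p j := by
        clear hbnu hbmu
        simp only [PairBM, PairRlex] at *
        omega
      have hql : PairBN b₂ c₂ d₂ q l := by
        clear hpj
        simp only [PairBM, PairBN, PairRlex] at *
        omega
      refine C.not_swap_Z_Z (single_add_single_le_of_ne hvm hum hvu) hv hu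
        (p := q) (q := l) (r := p) (s := j) (Or.inr hql) (Or.inl hpj) ?_
        (C.mrlexGt_iff.mpr (Or.inr (Or.inl ⟨hbm', hpj, ?_⟩)))
        (C.mrlexGt_iff.mpr (Or.inl ⟨hbnu, hpj⟩))
      · simp only [quad]
        abel
      · simp only [PairRlex]
        omega

/-- Some `T`-variable with indices `x`, `y` divides `m`. -/
def HasT {S₁ S₂ : Set (Fin n →₀ ℕ)} (m : ↥S₁ ⊕ ↥S₂ →₀ ℕ) (x y : ℕ) : Prop :=
  ∃ (v : ↥S₁ ⊕ ↥S₂) (x' y' : Fin n), m v ≠ 0 ∧ baseMonomial v = Sum.inl (quad x' y') ∧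
    (x' : ℕ) = x ∧ (y' : ℕ) = y

/-- The square of some `T`-variable with indices `x`, `y` divides `m`. -/
def HasSquareT {S₁ S₂ : Set (Fin n →₀ ℕ)} (m : ↥S₁ ⊕ ↥S₂ →₀ ℕ) (x y : ℕ) : Prop :=
  ∃ (v : ↥S₁ ⊕ ↥S₂) (x' y' : Fin n), Finsupp.single v 1 + Finsupp.single v 1 ≤ m ∧
    baseMonomial v = Sum.inl (quad x' y') ∧ (x' : ℕ) = x ∧ (y' : ℕ) = y

/-- Some `Z`-variable with indices `p ≤ q` divides `m`. -/
def HasZ {S₁ S₂ : Set (Fin n →₀ ℕ)} (m : ↥S₁ ⊕ ↥S₂ →₀ ℕ) (p q : ℕ) : Prop :=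
  ∃ (v : ↥S₁ ⊕ ↥S₂) (p' q' : Fin n), m v ≠ 0 ∧ p' ≤ q' ∧
    baseMonomial v = Sum.inr (quad p' q') ∧ (p' : ℕ) = p ∧ (q' : ℕ) = q

/-- A weight bounded by `A` on the first ideal and by `B` on the second falls short of `B` at `w`
by at most the total defect of `m`. -/
theorem le_weight (C : IrreducibleAbove a₁ b₁ c₁ d₁ a₂ b₂ c₂ d₂ m m' w)
    (hw : baseMonomial w = Sum.inr (quad i j)) (f : ℕ → ℤ) (A B : ℤ)
    (hA : ∀ x y, PairIn a₁ b₁ c₁ d₁ x y → f x + f y ≤ A)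
    (hB : ∀ x y, PairIn a₂ b₂ c₂ d₂ x y → f x + f y ≤ B) :
    B + weightHom (varWeight _ _ f (-A) (-B)) m ≤ f i + f j := by
  have hle := weightHom_le (g := varWeight _ _ f (-A) (-B)) (m := m') (fun v => by
    obtain ⟨x, y, -, h | h⟩ := exists_baseMonomial_eq v
    · rw [varWeight_of_inl _ _ _ h]
      linarith [hA x y (C.pairIn_of_inl h)]
    · rw [varWeight_of_inr _ _ _ h]
      linarith [hB x y (C.pairIn_of_inr h)]) C.pos
  rw [varWeight_of_inr _ _ _ hw, ← C.weight_eq] at hle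
  linarith

theorem varWeight_nonneg {f : ℕ → ℤ} {A B : ℤ} (hT : ∀ x y, HasT m x y → f x + f y = A)
    (hZ : ∀ p q, HasZ m p q → f p + f q = B) (hv : m v ≠ 0) :
    0 ≤ varWeight _ _ f (-A) (-B) v := by
  obtain ⟨x, y, hxy, h | h⟩ := exists_baseMonomial_eq v
  · rw [varWeight_of_inl _ _ _ h]
    linarith [hT x y ⟨v, x, y, hv, h, rfl, rfl⟩]
  · rw [varWeight_of_inr _ _ _ h]
    linarith [hZ x y ⟨v, x, y, hv, hxy, h, rfl, rfl⟩]

theorem weight_le (C : IrreducibleAbove a₁ b₁ c₁ d₁ a₂ b₂ c₂ d₂ m m' w)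
    (hw : baseMonomial w = Sum.inr (quad i j)) (f : ℕ → ℤ) (A B : ℤ)
    (hA : ∀ x y, PairIn a₁ b₁ c₁ d₁ x y → f x + f y ≤ A)
    (hB : ∀ x y, PairIn a₂ b₂ c₂ d₂ x y → f x + f y ≤ B)
    (hT : ∀ x y, HasT m x y → f x + f y = A) (hZ : ∀ p q, HasZ m p q → f p + f q = B) :
    B ≤ f i + f j := by
  have := C.le_weight hw f A B hA hB
  have := weightHom_nonneg (g := varWeight _ _ f (-A) (-B)) (m := m)
    fun v => varWeight_nonneg (v := v) hT hZ
  omega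

theorem weight_defect_le (C : IrreducibleAbove a₁ b₁ c₁ d₁ a₂ b₂ c₂ d₂ m m' w)
    (hw : baseMonomial w = Sum.inr (quad i j)) (f : ℕ → ℤ) (A B : ℤ) (x₀ y₀ : ℕ)
    (hsq : ¬ HasSquareT m x₀ y₀)
    (hA : ∀ x y, PairIn a₁ b₁ c₁ d₁ x y → f x + f y ≤ A)
    (hB : ∀ x y, PairIn a₂ b₂ c₂ d₂ x y → f x + f y ≤ B)
    (hT : ∀ x y, HasT m x y → f x + f y = A ∨ (x = x₀ ∧ y = y₀) ∨ (x = y₀ ∧ y = x₀))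
    (hA' : A - 1 ≤ f x₀ + f y₀) (hZ : ∀ p q, HasZ m p q → f p + f q = B) :
    B - 1 ≤ f i + f j := by
  by_cases hall : ∀ x y, HasT m x y → f x + f y = A
  · have := C.weight_le hw f A B hA hB hall hZ
    omega
  push Not at hall
  obtain ⟨x, y, hxy, hne⟩ := hall
  obtain ⟨e, x', y', hem, he, hx', hy'⟩ : HasT m x₀ y₀ := by
    obtain ⟨e, x', y', hem, he, hx', hy'⟩ := hxy
    rcases (hT x y ⟨e, x', y', hem, he, hx', hy'⟩).resolve_left hne with ⟨h1, h2⟩ | ⟨h1, h2⟩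
    · exact ⟨e, x', y', hem, he, hx'.trans h1, hy'.trans h2⟩
    · exact ⟨e, y', x', hem, by rwa [quad_comm], hy'.trans h2, hx'.trans h1⟩
  subst hx' hy'
  have hrest := weightHom_nonneg (g := varWeight _ _ f (-A) (-B)) (m := m - Finsupp.single e 1)
    (fun v hv => by
      have hle := single_add_single_le_of_tsub hem hv
      have hvm := ne_zero_of_single_add_le hle
      obtain ⟨x, y, hxy, h | h⟩ := exists_baseMonomial_eq v
      · rw [varWeight_of_inl _ _ _ h]
        rcases hT x y ⟨v, x, y, hvm, h, rfl, rfl⟩ with h' | h'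
        · linarith
        · exfalso
          have hve : v = e := by
            refine baseMonomial_injective (h.trans (Eq.trans ?_ he.symm))
            rw [quad_eq_quad_iff.mpr]
            simpa only [Fin.ext_iff] using h'
          subst hve
          exact hsq ⟨v, x', y', hle, he, rfl, rfl⟩
      · rw [varWeight_of_inr _ _ _ h]
        linarith [hZ x y ⟨v, x, y, hvm, hxy, h, rfl, rfl⟩])
  have hsum := weightHom_eq_add_tsub (varWeight _ _ f (-A) (-B)) hem
  rw [varWeight_of_inl _ _ _ he] at hsum
  have := C.le_weight hw f A B hA hB
  omega

theorem tailConfig (C : IrreducibleAbove a₁ b₁ c₁ d₁ a₂ b₂ c₂ d₂ m m' w) (hij : i ≤ j)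
    (hw : baseMonomial w = Sum.inr (quad i j)) (hbm : PairBM a₂ b₂ i j)
    (hbn : ∀ {p q}, HasZ m p q → p ≤ c₂ ∧ b₂ < q ∧ q ≤ d₂) :
    TailConfig a₁ b₁ c₁ d₁ a₂ b₂ c₂ d₂ (HasT m) (HasZ m) (HasSquareT m) i j := by
  have hca := C.ca₂
  have hab := C.ab₂
  refine
    { symm := ?_
      mem := ?_
      bn := hbn
      bm := ?_
      swap_tail := ?_
      drop_tail := ?_
      swap_both := ?_
      swap_T := ?_
      weight := C.weight_le hw
      weight_defect := C.weight_defect_le hw }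
  · rintro x y ⟨v, x', y', hv, h, hx, hy⟩
    exact ⟨v, y', x', hv, by rwa [quad_comm], hy, hx⟩
  · rintro x y ⟨v, x', y', hv, h, rfl, rfl⟩
    exact C.pairIn_of_inl h
  · simp only [PairBM] at hbm
    omega
  · rintro x y p q ⟨v, x, y, hv, h, rfl, rfl⟩ hz hin hlt hle
    have hz' := hbn hz
    obtain ⟨u, p, q, hu, hpq, h', rfl, rfl⟩ := hz
    refine C.not_swap_T_Z hv hu h h' hin (r := p) (s := y) ?_ ?_ (C.mrlexGt_iff.mpr ?_)
    · simp only [PairIn, PairBM, PairBN] at *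
      omega
    · simp only [quad]
      abel
    · simp only [PairBM, PairBN, PairRlex] at *
      omega
  · rintro x y p q ⟨v, x, y, hv, h, rfl, rfl⟩ hz hin hle
    have hz' := hbn hz
    obtain ⟨u, p, q, hu, hpq, h', rfl, rfl⟩ := hz
    refine C.not_swap_T_Z hv hu h h' hin (r := p) (s := y) ?_ ?_ (C.mrlexGt_iff.mpr ?_)
    · simp only [PairIn, PairBM, PairBN] at *
      omega
    · simp only [quad]
      abel
    · simp only [PairBM, PairBN, PairRlex] at *
      omega
  · rintro x y p q ⟨v, x, y, hv, h, rfl, rfl⟩ hz hin hxy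
    have hz' := hbn hz
    obtain ⟨u, p, q, hu, hpq, h', rfl, rfl⟩ := hz
    exact C.not_swap_T_Z hv hu h h' hin (Or.inl hxy) (add_comm _ _)
      (C.mrlexGt_iff.mpr (Or.inl ⟨Or.inl hz', hxy⟩))
  · rintro x y x' y' ⟨v, x, y, hv, h, rfl, rfl⟩ ⟨u, x', y', hu, h', rfl, rfl⟩ hne hx hy hgt hgt'
    have hle : Finsupp.single v 1 + Finsupp.single u 1 ≤ m := by
      by_cases hvu : v = u
      · subst hvu
        rw [h, Sum.inl.injEq, quad_eq_quad_iff] at h'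
        have hD : HasSquareT m x y := by
          simp only [PairRlex, Fin.ext_iff] at *
          rcases hne with hne | hne | hne
          · omega
          · omega
          · exact hne
        obtain ⟨e, p, q, hle, he, hp, hq⟩ := hD
        obtain rfl : p = x := Fin.ext hp
        obtain rfl : q = y := Fin.ext hq
        obtain rfl : e = v := baseMonomial_injective (he.trans h.symm)
        exact hle
      · exact single_add_single_le_of_ne hv hu hvu
    refine C.not_swap_T_T hle h h' hy hx ?_ hgt hgt'
    simp only [quad]
    abel

theorem elim (C : IrreducibleAbove a₁ b₁ c₁ d₁ a₂ b₂ c₂ d₂ m m' w) : False := by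
  have hca := C.ca₂
  have hab := C.ab₂
  obtain ⟨i, j, hij, hw | hw⟩ := exists_baseMonomial_eq w
  · exact C.not_inl hij hw
  rcases C.pairIn_of_inr hw with hbm | hbn
  swap
  · exact C.not_inr_BN hij hw hbn
  have hZ : ∀ {p q}, HasZ m p q → p ≤ c₂ ∧ b₂ < q ∧ q ≤ d₂ := by
    rintro p q ⟨v, p, q, hv, hpq, h, rfl, rfl⟩
    have hbn := (C.pairIn_of_inr h).resolve_left fun hbm' => C.not_inr_BM hij hw hbm hpq hv h hbm'
    simp only [PairBN] at hbn
    omega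
  have hcross : ∀ {p q p' q'}, HasZ m p q → HasZ m p' q' → p < p' → q' < q → False := by
    intro p q p' q' hz hz' hp hq
    have hbn := hZ hz
    have hbn' := hZ hz'
    obtain ⟨v, p, q, hv, hpq, h, rfl, rfl⟩ := hz
    obtain ⟨u, p', q', hu, hpq', h', rfl, rfl⟩ := hz'
    have hvu : v ≠ u := by
      rintro rfl
      rw [h, Sum.inr.injEq, quad_eq_quad_iff] at h'
      simp only [Fin.ext_iff] at h'
      omega
    refine C.not_swap_Z_Z (single_add_single_le_of_ne hv hu hvu) h h'
      (p := p) (q := q') (r := p') (s := q) (Or.inr (Or.inl (by omega)))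
      (Or.inr (Or.inl (by omega))) ?_ (C.mrlexGt_iff.mpr ?_) (C.mrlexGt_iff.mpr ?_)
    · simp only [quad]
      abel
    · simp only [PairBM, PairBN, PairRlex]
      omega
    · simp only [PairBM, PairBN, PairRlex]
      omega
  classical
  have hex : ∃ k p q, HasZ m p q ∧ p + q = k := by
    obtain ⟨v, hv, p, q, hpq, h⟩ := C.exists_Z hw
    exact ⟨_, p, q, ⟨v, p, q, hv, hpq, h, rfl, rfl⟩, rfl⟩
  obtain ⟨p₀, q₀, hz₀, hsum⟩ := Nat.find_spec hex
  have hmin : ∀ p q, HasZ m p q → p₀ + q₀ ≤ p + q := fun p q h => by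
    rw [hsum]
    exact Nat.find_min' hex ⟨p, q, h, rfl⟩
  refine (C.tailConfig hij hw hbm hZ).not_config C.ca₁ C.ab₁ C.bd₁ C.ca₂ C.ab₂ C.dd hz₀ ?_
  intro p q h
  have h1 := hmin p q h
  have h2 : ¬ (p < p₀ ∧ q₀ < q) := fun h' => hcross h hz₀ h'.1 h'.2
  have h3 : ¬ (p₀ < p ∧ q < q₀) := fun h' => hcross hz₀ h h'.1 h'.2
  omega

end IrreducibleAbove

/-- A monomial which is greater than another monomial in its fiber is divisible by a marked
term. -/
theorem exists_head_le_of_varRevlexGt {n : ℕ} {a₁ b₁ c₁ d₁ a₂ b₂ c₂ d₂ : Fin n}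
    (h11 : c₁ < a₁) (h12 : a₁ ≤ b₁) (h13 : b₁ < d₁) (h21 : c₂ < a₂) (h22 : a₂ ≤ b₂)
    (hd : d₁ ≤ d₂) (m m' : ↥(BM a₁ b₁ ∪ BN b₁ c₁ d₁) ⊕ ↥(BM a₂ b₂ ∪ BN b₂ c₂ d₂) →₀ ℕ)
    (hfib : fiberMap (TZexp _ _) m = fiberMap (TZexp _ _) m')
    (hgt : VarRevlexGt (HTVarGt a₂ b₂ c₂ d₂ _ _) m m') :
    ∃ g ∈ GHT a₁ b₁ c₁ d₁ a₂ b₂ c₂ d₂, g.head ≤ m := by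
  by_contra! hno
  have hdeg : (m.sum fun _ e => e) = m'.sum fun _ e => e := by
    have hone : varWeight (BM a₁ b₁ ∪ BN b₁ c₁ d₁) (BM a₂ b₂ ∪ BN b₂ c₂ d₂) 0 1 1 =
        fun _ => 1 := by
      funext v
      obtain ⟨x, y, -, h | h⟩ := exists_baseMonomial_eq v
      · simp [varWeight_of_inl _ _ _ h]
      · simp [varWeight_of_inr _ _ _ h]
    have := congrArg (weightHom (Sum.elim (fun i : Fin n => (0 : ℕ → ℤ) i) ![1, 1])) hfib
    rw [weightHom_fiberMap, weightHom_fiberMap] at this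
    change weightHom (varWeight _ _ 0 1 1) m = weightHom (varWeight _ _ 0 1 1) m' at this
    rw [hone, weightHom_eq_sum, weightHom_eq_sum] at this
    simpa [Finsupp.sum, ← Nat.cast_sum] using this
  obtain hlt | ⟨-, w, hw, hlow⟩ := hgt
  · exact absurd hdeg hlt.ne'
  have hinf : m - m' + m ⊓ m' = m := by
    ext v
    simp only [Finsupp.add_apply, Finsupp.tsub_apply, Finsupp.inf_apply]
    omega
  have hinf' : m' - m + m ⊓ m' = m' := by
    ext v
    simp only [Finsupp.add_apply, Finsupp.tsub_apply, Finsupp.inf_apply]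
    omega
  refine IrreducibleAbove.elim (m := m - m') (m' := m' - m) (w := w)
    ⟨h11, h12, h13, h21, h22, hd, ?_, ?_, ?_, fun g hg hle => hno g hg (hle.trans tsub_le_self)⟩
  · have h := congrArg (fiberMap (TZexp _ _)) hinf
    have h' := congrArg (fiberMap (TZexp _ _)) hinf'
    rw [fiberMap_add] at h h'
    exact add_right_cancel (h.trans (hfib.trans h'.symm))
  · rw [Finsupp.tsub_apply]
    omega
  · intro v hv
    rw [Finsupp.tsub_apply] at hv
    refine (HTVarGt.total h22 (v := v) (w := w) ?_).resolve_right fun h => ?_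
    · rintro rfl
      omega
    · have := hlow v h
      omega

theorem fiberMap_head_eq {n : ℕ} {a₁ b₁ c₁ d₁ a₂ b₂ c₂ d₂ : Fin n} :
    ∀ g ∈ GHT a₁ b₁ c₁ d₁ a₂ b₂ c₂ d₂,
      fiberMap (TZexp _ _) g.head = fiberMap (TZexp _ _) g.tail := by
  rintro g ((⟨⟨_, _⟩, ⟨u, v, u', v', h, -, -, rfl, rfl⟩, rfl⟩ |
    ⟨⟨_, _⟩, ⟨u, v, u', v', h, -, -, rfl, rfl⟩, rfl⟩) | ⟨u, u', v, v', h, -, hhead, htail⟩)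
  all_goals
    have h' := congrArg (Finsupp.mapDomain (Sum.inl : Fin n → Fin n ⊕ Fin 2)) h
    rw [Finsupp.mapDomain_add, Finsupp.mapDomain_add] at h'
  · simp only [MarkedBinomial.map, Finsupp.mapDomain_add, Finsupp.mapDomain_single,
      fiberMap_add, fiberMap_single, TZexp, Sum.elim_inl]
    rw [add_add_add_comm, h', add_add_add_comm]
  · simp only [MarkedBinomial.map, Finsupp.mapDomain_add, Finsupp.mapDomain_single,
      fiberMap_add, fiberMap_single, TZexp, Sum.elim_inr]
    rw [add_add_add_comm, h', add_add_add_comm]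
  · simp only [hhead, htail, fiberMap_add, fiberMap_single, TZexp, Sum.elim_inl, Sum.elim_inr]
    rw [add_add_add_comm, h', add_add_add_comm]

theorem varRevlexGt_head_tail {n : ℕ} {a₁ b₁ c₁ d₁ a₂ b₂ c₂ d₂ : Fin n} (h22 : a₂ ≤ b₂) :
    ∀ g ∈ GHT a₁ b₁ c₁ d₁ a₂ b₂ c₂ d₂,
      VarRevlexGt (HTVarGt a₂ b₂ c₂ d₂ _ _) g.head g.tail := by
  rintro g ((⟨⟨_, _⟩, ⟨u, v, u', v', -, hu, hv, rfl, rfl⟩, rfl⟩ |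
    ⟨⟨_, _⟩, ⟨u, v, u', v', -, hu, hv, rfl, rfl⟩, rfl⟩) | ⟨u, u', v, v', -, hv, hhead, htail⟩)
  · simp only [MarkedBinomial.map, Finsupp.mapDomain_add, Finsupp.mapDomain_single]
    exact varRevlexGt_single_add_single (HTVarGt.irrefl h22) (HTVarGt.trans h22) hu hv
  · simp only [MarkedBinomial.map, Finsupp.mapDomain_add, Finsupp.mapDomain_single]
    exact varRevlexGt_single_add_single (HTVarGt.irrefl h22) (HTVarGt.trans h22) hu hv
  · rw [hhead, htail]
    exact varRevlexGt_single_add_single (HTVarGt.irrefl h22) (HTVarGt.trans h22) trivial hv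

/-- For strongly stable ideals `I₁ = B(x_{a₁}x_{b₁}, x_{c₁}x_{d₁})` and
`I₂ = B(x_{a₂}x_{b₂}, x_{c₂}x_{d₂})` with `cᵢ < aᵢ ≤ bᵢ < dᵢ` and `d₁ ≤ d₂`, the
collection `G = G₁ ∪ G₂ ∪ G₃` is a Gröbner basis of the toric ideal `T(I₁ ⊕ I₂)` with
respect to the head and tail order `≻_ht` on `K[T_u, Z_v]`, with the marked terms as
initial terms. -/
theorem headAndTail_GroebnerBasis {n : ℕ} {K : Type} [Field K]
    (a₁ b₁ c₁ d₁ a₂ b₂ c₂ d₂ : Fin n)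
    (h11 : c₁ < a₁) (h12 : a₁ ≤ b₁) (h13 : b₁ < d₁)
    (h21 : c₂ < a₂) (h22 : a₂ ≤ b₂) (h23 : b₂ < d₂) (hd : d₁ ≤ d₂)
    (φ : MvPolynomial (↥(BM a₁ b₁ ∪ BN b₁ c₁ d₁) ⊕ ↥(BM a₂ b₂ ∪ BN b₂ c₂ d₂)) K →ₐ[K]
      MvPolynomial (Fin n ⊕ Fin 2) K)
    (hφ : φ = MvPolynomial.aeval (fun w =>
      MvPolynomial.monomial (TZexp (BM a₁ b₁ ∪ BN b₁ c₁ d₁) (BM a₂ b₂ ∪ BN b₂ c₂ d₂) w)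
        (1 : K))) :
    IsMarkedGB
      (VarRevlexGt (HTVarGt a₂ b₂ c₂ d₂ (BM a₁ b₁ ∪ BN b₁ c₁ d₁) (BM a₂ b₂ ∪ BN b₂ c₂ d₂)))
      (GHT a₁ b₁ c₁ d₁ a₂ b₂ c₂ d₂) (RingHom.ker φ.toRingHom) := by
  subst hφ
  exact isMarkedGB_of_fiberMap _ _ _ (VarRevlexGt.irrefl _) fiberMap_head_eq
    (varRevlexGt_head_tail h22) (exists_head_le_of_varRevlexGt h11 h12 h13 h21 h22 hd)
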